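/- arXiv:2605.25491 — 2 statements merged into one kernel-verified Lean document; each statement's English description precedes it below -/
import Mathlib

section
/- Let X, u, a mesh (d_n) with partial sums t_n, and x_n := ρ_n u(t_n) be as in the standing construction, and set C := the closed convex hull of {x_n : n ≥ 2}. Then there exists a map T : X → X that is firmly nonexpansive (i.e., ‖T a − T b‖^2 ≤ ⟨a − b, T a − T b⟩ for all a, b ∈ X) such that: the closure of the range of T equals C; the fixed point set of T is exactly {0}; T x_n = x_{n+1} for every n ≥ 1; the iterates T^n x_1 converge weakly to 0 (i.e., ⟨T^n x_1, y⟩ → 0 for every y ∈ X); and inf_{n ≥ 1} ‖T^n x_1‖ = ρ_∞ > 0, so the iterates do not converge strongly to 0. -/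
open Filter
open scoped RealInnerProductSpace

/-- A mesh: positive step sizes `d n` (for `n ≥ 1`) with square-summable
increments, partial sums `t n = ∑_{k=1}^{n-1} d k` tending to `+∞`,
`d 1 ≤ 1/8` and `d (n+1) ≤ d n / (1 + 64 d n ²)`. -/
def IsMesh (d : ℕ → ℝ) : Prop :=
  (∀ n : ℕ, 1 ≤ n → 0 < d n) ∧
  (Summable fun k : ℕ => d (k + 1) ^ 2) ∧
  Tendsto (fun n : ℕ => ∑ k ∈ Finset.Ico 1 n, d k) atTop atTop ∧
  d 1 ≤ 1 / 8 ∧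
  (∀ n : ℕ, 1 ≤ n → d (n + 1) ≤ d n / (1 + 64 * d n ^ 2))


section helpers
variable {X : Type*} [NormedAddCommGroup X] [InnerProductSpace ℝ X]

lemma aux_conv (p q w y z : X) (μ a : ℝ) :
    ⟪(a • y + (1 - a) • z) - p, q - μ • (w - (a • y + (1 - a) • z))⟫
      = a * ⟪y - p, q - μ • (w - y)⟫ + (1 - a) * ⟪z - p, q - μ • (w - z)⟫
        - μ * (a * (1 - a)) * ⟪y - z, y - z⟫ := by
  simp only [inner_add_left, inner_add_right, inner_sub_left, inner_sub_right, inner_smul_left,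
    inner_smul_right, RCLike.conj_to_real]
  rw [real_inner_comm y z]
  ring

lemma aux_sum {ι : Type*} [Fintype ι] (p q : ι → X)
    (mono : ∀ i j, 0 ≤ ⟪p i - p j, q i - q j⟫) (l : ι → ℝ) (hl : ∀ i, 0 ≤ l i)
    (hL : 0 < ∑ i, l i) (y : X) (hy : (∑ i, l i) • y = ∑ i, l i • p i) (w : X) (μ : ℝ) :
    ∑ i, l i * ⟪y - p i, q i - μ • (w - y)⟫ ≤ 0 := by
  have h1 : ∑ i, l i * ⟪y - p i, q i - μ • (w - y)⟫ = ∑ i, l i * ⟪y - p i, q i⟫ := by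
    have : ∑ i, l i * ⟪y - p i, μ • (w - y)⟫ = 0 := by
      have : ∑ i, l i * ⟪y - p i, μ • (w - y)⟫ = ⟪∑ i, l i • (y - p i), μ • (w - y)⟫ := by
        rw [sum_inner]; simp only [inner_smul_left, RCLike.conj_to_real]
      rw [this]
      simp only [smul_sub, Finset.sum_sub_distrib]
      rw [← Finset.sum_smul, hy, sub_self, inner_zero_left]
    simp only [inner_sub_right (y - p _) (q _), mul_sub, Finset.sum_sub_distrib, this, sub_zero]
  rw [h1]
  have h2 : (∑ i, l i) * ∑ i, l i * ⟪y - p i, q i⟫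
      = ∑ i, ∑ j, l i * l j * ⟪p j - p i, q i⟫ := by
    rw [Finset.mul_sum]
    refine Finset.sum_congr rfl fun i _ => ?_
    have : ∑ j, l i * l j * ⟪p j - p i, q i⟫ = l i * ⟪∑ j, l j • (p j - p i), q i⟫ := by
      rw [sum_inner, Finset.mul_sum]; simp only [inner_smul_left, RCLike.conj_to_real, mul_assoc]
    rw [this]
    simp only [smul_sub, Finset.sum_sub_distrib]
    rw [← Finset.sum_smul, ← hy, ← smul_sub, inner_smul_left]
    simp only [RCLike.conj_to_real]; ring
  have h3 : ∑ i, ∑ j, l i * l j * ⟪p j - p i, q i⟫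
      = ∑ i, ∑ j, l i * l j * ⟪p i - p j, q j⟫ := by
    rw [Finset.sum_comm]
    refine Finset.sum_congr rfl fun i _ => Finset.sum_congr rfl fun j _ => ?_
    ring
  have h4 : ∑ i, ∑ j, l i * l j * ⟪p j - p i, q i⟫ + ∑ i, ∑ j, l i * l j * ⟪p i - p j, q j⟫ ≤ 0 := by
    rw [← Finset.sum_add_distrib]
    refine Finset.sum_nonpos fun i _ => ?_
    rw [← Finset.sum_add_distrib]
    refine Finset.sum_nonpos fun j _ => ?_
    have e : l i * l j * ⟪p j - p i, q i⟫ + l i * l j * ⟪p i - p j, q j⟫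
        = - (l i * l j * ⟪p i - p j, q i - q j⟫) := by
      simp only [inner_sub_left, inner_sub_right]; ring
    rw [e]
    have := mul_nonneg (mul_nonneg (hl i) (hl j)) (mono i j)
    linarith
  have h5 : (∑ i, l i) * ∑ i, l i * ⟪y - p i, q i⟫ ≤ 0 := by linarith
  by_contra h; push Not at h
  have := mul_pos hL h
  linarith

lemma finite_DF {ι : Type*} [Fintype ι] [DecidableEq ι] {C : Set X} (hC : Convex ℝ C)
    (hne : C.Nonempty)
    (p q : ι → X) (hp : ∀ i, p i ∈ C) (mono : ∀ i j, 0 ≤ ⟪p i - p j, q i - q j⟫)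
    (ε : ι → ℝ) (hε : ∀ i, 0 < ε i) (w : X) (μ : ℝ) (hμ : 0 < μ) :
    ∃ y ∈ C, ∀ i, ⟪y - p i, q i - μ • (w - y)⟫ < ε i := by
  set f : ι → X → ℝ := fun i y => ⟪y - p i, q i - μ • (w - y)⟫ with hf
  set S : Set (ι → ℝ) := {v | ∃ y ∈ C, ∀ i, f i y < v i} with hS
  by_contra hcon
  have hmem : ε ∉ S := hcon
  have hopen : IsOpen S := by
    have : S = ⋃ y ∈ C, Set.pi Set.univ (fun i => Set.Ioi (f i y)) := by
      ext v; simp [hS]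
    rw [this]
    exact isOpen_biUnion fun y _ => isOpen_set_pi Set.finite_univ fun i _ => isOpen_Ioi
  have hconv : Convex ℝ S := by
    rintro v ⟨y, hy, hv⟩ v' ⟨z, hz, hv'⟩ a b ha hb hab
    refine ⟨a • y + b • z, hC hy hz ha hb hab, fun i => ?_⟩
    obtain rfl : b = 1 - a := by linarith
    have e := aux_conv (p i) (q i) w y z μ a
    have e2 : 0 ≤ μ * (a * (1 - a)) * ⟪y - z, y - z⟫ :=
      mul_nonneg (mul_nonneg hμ.le (mul_nonneg ha hb)) real_inner_self_nonneg
    have h1 := hv i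
    have h2 := hv' i
    simp only [hf] at h1 h2 ⊢
    rw [e]
    simp only [Pi.add_apply, Pi.smul_apply, smul_eq_mul]
    rcases ha.eq_or_lt with rfl | ha'
    · simp only [sub_zero, zero_mul, zero_add, one_mul] at *; linarith
    · nlinarith
  obtain ⟨φ, hφ⟩ := geometric_hahn_banach_point_open hconv hopen hmem
  set l : ι → ℝ := fun i => φ (Pi.single i 1) with hl
  have hφs : ∀ v : ι → ℝ, φ v = ∑ i, l i * v i := by
    intro v
    conv_lhs => rw [pi_eq_sum_univ' v]
    rw [map_sum]
    refine Finset.sum_congr rfl fun i _ => ?_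
    rw [map_smul, smul_eq_mul, mul_comm]
  obtain ⟨y0, hy0⟩ := hne
  have hl0 : ∀ i, 0 ≤ l i := by
    intro i
    by_contra hneg; push Not at hneg
    set v0 : ι → ℝ := fun i => f i y0 + 1 with hv0
    have key : ∀ c : ℝ, 0 ≤ c → φ ε < φ v0 + c * l i := by
      intro c hc
      have : v0 + c • Pi.single i (1:ℝ) ∈ S := by
        refine ⟨y0, hy0, fun j => ?_⟩
        have : (0:ℝ) ≤ (Pi.single i (1:ℝ) : ι → ℝ) j := by
          by_cases h : j = i
          · subst h; simp
          · simp [h]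
        simp only [Pi.add_apply, Pi.smul_apply, smul_eq_mul, hv0]
        nlinarith [mul_nonneg hc this]
      have := hφ _ this
      rwa [map_add, map_smul, smul_eq_mul] at this
    have h0 := key 0 le_rfl
    have := key ((φ v0 - φ ε) / (- l i)) (div_nonneg (by linarith) (by linarith))
    have e : (φ v0 - φ ε) / (- l i) * l i = - (φ v0 - φ ε) := by
      have : l i ≠ 0 := hneg.ne
      field_simp
    linarith
  have hLpos : 0 < ∑ i, l i := by
    rcases (Finset.sum_nonneg fun i (_ : i ∈ Finset.univ) => hl0 i).eq_or_lt with h | h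
    · exfalso
      have h0 := (Finset.sum_eq_zero_iff_of_nonneg fun i (_ : i ∈ Finset.univ) => hl0 i).1 h.symm
      have : (fun i => f i y0 + 1) ∈ S := ⟨y0, hy0, fun j => by simp⟩
      have := hφ _ this
      rw [hφs, hφs, Finset.sum_eq_zero, Finset.sum_eq_zero] at this
      · exact lt_irrefl _ this
      · intro i hi; rw [h0 i hi, zero_mul]
      · intro i hi; rw [h0 i hi, zero_mul]
    · exact h
  set y : X := (∑ i, l i)⁻¹ • ∑ i, l i • p i with hy
  have hyC : y ∈ C := by
    have := hC.centerMass_mem (t := Finset.univ) (w := l) (z := p) (fun i _ => hl0 i) hLpos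
      (fun i _ => hp i)
    exact this
  have hys : (∑ i, l i) • y = ∑ i, l i • p i := by
    rw [hy, smul_smul, mul_inv_cancel₀ hLpos.ne', one_smul]
  have hle := aux_sum p q mono l hl0 hLpos y hys w μ
  have : (fun i => f i y + ε i / 2) ∈ S := ⟨y, hyC, fun j => by simp [hε j]⟩
  have := hφ _ this
  rw [hφs, hφs] at this
  simp only [mul_add, Finset.sum_add_distrib] at this
  have e : ∑ i, l i * (ε i / 2) = (∑ i, l i * ε i) / 2 := by
    rw [Finset.sum_div]; exact Finset.sum_congr rfl fun i _ => by ring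
  have hnn : 0 ≤ ∑ i, l i * ε i := Finset.sum_nonneg fun i _ => mul_nonneg (hl0 i) (hε i).le
  rw [e] at this
  simp only [hf] at this
  linarith

lemma hilbert_fip [CompleteSpace X] {ι : Type*} (F : ι → Set X) (R : ℝ)
    (hb : ∀ i, F i ⊆ Metric.closedBall 0 R) (hcl : ∀ i, IsClosed (F i))
    (hcv : ∀ i, Convex ℝ (F i)) (hfin : ∀ s : Finset ι, (Metric.closedBall (0:X) R ∩ ⋂ i ∈ s, F i).Nonempty) :
    (Metric.closedBall (0:X) R ∩ ⋂ i, F i).Nonempty := by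
  let Φ : WeakDual ℝ X → X := fun φ => (InnerProductSpace.toDual ℝ X).symm (WeakDual.toStrongDual φ)
  have hK := WeakDual.isCompact_closedBall (𝕜 := ℝ) (E := X) 0 R
  have hΦ : ∀ φ z, ⟪Φ φ, z⟫ = φ z := by
    intro φ z
    simp only [Φ, InnerProductSpace.toDual_symm_apply]; rfl
  have hclosed : ∀ i, IsClosed (Φ ⁻¹' F i) := by
    intro i
    rw [← isOpen_compl_iff, isOpen_iff_mem_nhds]
    intro φ hφ
    obtain ⟨g, u, hg1, hg2⟩ := geometric_hahn_banach_closed_point (hcv i) (hcl i) hφ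
    set z := (InnerProductSpace.toDual ℝ X).symm g with hz
    have hgz : ∀ a, g a = ⟪a, z⟫ := by
      intro a; rw [real_inner_comm, hz, InnerProductSpace.toDual_symm_apply]
    have ho : IsOpen {ψ : WeakDual ℝ X | u < ψ z} :=
      isOpen_lt continuous_const (WeakDual.eval_continuous z)
    refine Filter.mem_of_superset (ho.mem_nhds ?_) ?_
    · rw [hgz, hΦ] at hg2; exact hg2
    · intro ψ hψ hmem
      have := hg1 _ hmem
      rw [hgz, hΦ] at this
      exact absurd hψ (not_lt.2 this.le)
  have hnorm : ∀ φ : WeakDual ℝ X, φ ∈ (WeakDual.toStrongDual ⁻¹' Metric.closedBall 0 R : Set (WeakDual ℝ X)) ↔ Φ φ ∈ Metric.closedBall (0:X) R := by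
    intro φ
    simp [Φ]
  obtain ⟨φ, h1, h2⟩ := hK.inter_iInter_nonempty (fun i => Φ ⁻¹' F i) hclosed (by
    intro s
    obtain ⟨y, hy1, hy2⟩ := hfin s
    let ψ : WeakDual ℝ X := WeakDual.toStrongDual.symm (InnerProductSpace.toDual ℝ X y)
    have hψ : Φ ψ = y := by simp [Φ, ψ]
    refine ⟨ψ, (hnorm ψ).2 (hψ ▸ hy1), ?_⟩
    simp only [Set.mem_iInter, Set.mem_preimage, hψ] at hy2 ⊢
    exact hy2)
  refine ⟨Φ φ, (hnorm φ).1 h1, ?_⟩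
  simpa using h2

def MonoSet (C : Set X) (G : Set (X × X)) : Prop :=
  (∀ a ∈ G, a.1 ∈ C) ∧ ∀ a ∈ G, ∀ b ∈ G, 0 ≤ ⟪a.1 - b.1, a.2 - b.2⟫

lemma debrunner_flor [CompleteSpace X] {C : Set X} (hC : Convex ℝ C) (hcl : IsClosed C)
    (hne : C.Nonempty) (R : ℝ) (hR : C ⊆ Metric.closedBall 0 R) {G : Set (X × X)}
    (hG : MonoSet C G) (w : X) (μ : ℝ) (hμ : 0 < μ) :
    ∃ y ∈ C, ∀ a ∈ G, ⟪y - a.1, a.2 - μ • (w - y)⟫ ≤ 0 := by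
  classical
  let F : Option (G × {e : ℝ // 0 < e}) → Set X := fun o => match o with
    | none => C
    | some k => {y | y ∈ C ∧ ⟪y - k.1.1.1, k.1.1.2 - μ • (w - y)⟫ ≤ k.2.1}
  obtain ⟨y, -, hy⟩ := hilbert_fip F R (by
      rintro (_ | k)
      · exact hR
      · exact fun y hy => hR hy.1) (by
      rintro (_ | k)
      · exact hcl
      · refine hcl.inter (isClosed_le (f := fun y : X => ⟪y - k.1.1.1, k.1.1.2 - μ • (w - y)⟫) ?_ continuous_const); fun_prop) (by
      rintro (_ | k)
      · exact hC
      · rintro y ⟨hy, hy'⟩ z ⟨hz, hz'⟩ a b ha hb hab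
        refine ⟨hC hy hz ha hb hab, ?_⟩
        obtain rfl : b = 1 - a := by linarith
        rw [aux_conv]
        have e2 : 0 ≤ μ * (a * (1 - a)) * ⟪y - z, y - z⟫ :=
          mul_nonneg (mul_nonneg hμ.le (mul_nonneg ha hb)) real_inner_self_nonneg
        nlinarith) (by
      intro s
      let s' := s.eraseNone
      obtain ⟨y, hyC, hy⟩ := finite_DF (ι := s') hC hne (fun i => i.1.1.1.1) (fun i => i.1.1.1.2)
        (fun i => hG.1 _ i.1.1.2) (fun i j => hG.2 _ i.1.1.2 _ j.1.1.2) (fun i => i.1.2.1)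
        (fun i => i.1.2.2) w μ hμ
      refine ⟨y, hR hyC, ?_⟩
      simp only [Set.mem_iInter]
      rintro (_ | k) hk
      · exact hyC
      · exact ⟨hyC, (hy ⟨k, by simpa [s'] using hk⟩).le⟩)
  simp only [Set.mem_iInter] at hy
  refine ⟨y, hy none, fun a ha => ?_⟩
  refine le_of_forall_pos_le_add fun e he => ?_
  have := (hy (some (⟨a, ha⟩, ⟨e, he⟩))).2
  simpa using this

lemma firm_ext [CompleteSpace X] {C : Set X} (hC : Convex ℝ C) (hcl : IsClosed C)
    (hne : C.Nonempty) (R : ℝ) (hR : C ⊆ Metric.closedBall 0 R) {G0 : Set (X × X)}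
    (hG0 : MonoSet C G0) :
    ∃ T : X → X, (∀ a b : X, ‖T a - T b‖ ^ 2 ≤ ⟪a - b, T a - T b⟫) ∧
      (∀ a, T a ∈ C) ∧ (∀ a ∈ G0, T (a.1 + a.2) = a.1) ∧
      (∀ (w : X) (μ : ℝ), 0 < μ → ∃ y ∈ Set.range T, ∀ a ∈ G0, ⟪y - a.1, a.2 - μ • (w - y)⟫ ≤ 0) := by
  obtain ⟨G, hsub, hmax⟩ := zorn_subset_nonempty {G : Set (X × X) | MonoSet C G} (by
    intro c hc hchain hcne
    refine ⟨⋃₀ c, ⟨?_, ?_⟩, fun s hs => Set.subset_sUnion_of_mem hs⟩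
    · rintro a ⟨s, hs, ha⟩; exact (hc hs).1 a ha
    · rintro a ⟨s, hs, ha⟩ b ⟨s', hs', hb⟩
      rcases hchain.total hs hs' with h | h
      · exact (hc hs').2 a (h ha) b hb
      · exact (hc hs).2 a ha b (h hb)) G0 hG0
  have hG : MonoSet C G := hmax.prop
  have key : ∀ (w : X) (μ : ℝ), 0 < μ → ∃ y, (y, μ • (w - y)) ∈ G := by
    intro w μ hμ
    obtain ⟨y, hyC, hy⟩ := debrunner_flor hC hcl hne R hR hG w μ hμ
    refine ⟨y, ?_⟩
    have hins : MonoSet C (insert (y, μ • (w - y)) G) := by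
      have hflip : ∀ a ∈ G, 0 ≤ ⟪y - a.1, μ • (w - y) - a.2⟫ := by
        intro a ha
        have := hy a ha
        rw [← neg_sub (μ • (w - y)), inner_neg_right] at this
        linarith
      refine ⟨?_, ?_⟩
      · rintro a (rfl | ha)
        · exact hyC
        · exact hG.1 a ha
      · rintro a (rfl | ha) b (rfl | hb)
        · simp
        · exact hflip b hb
        · have := hflip a ha
          rw [← neg_sub, ← neg_sub a.2, inner_neg_neg] at this
          exact this
        · exact hG.2 a ha b hb
    exact hmax.le_of_ge hins (Set.subset_insert _ _) (Set.mem_insert _ _)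
  have key1 : ∀ w, ∃ y, (y, w - y) ∈ G := by
    intro w; simpa using key w 1 one_pos
  choose T hT using key1
  have huniq : ∀ a ∈ G, T (a.1 + a.2) = a.1 := by
    intro a ha
    have := hG.2 _ (hT (a.1 + a.2)) a ha
    simp only at this
    have e : a.1 + a.2 - T (a.1 + a.2) - a.2 = - (T (a.1 + a.2) - a.1) := by abel
    rw [e, inner_neg_right, real_inner_self_eq_norm_sq] at this
    have h0 : ‖T (a.1 + a.2) - a.1‖ = 0 := by
      nlinarith [norm_nonneg (T (a.1 + a.2) - a.1)]
    exact sub_eq_zero.1 (norm_eq_zero.1 h0)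
  refine ⟨T, ?_, fun a => hG.1 _ (hT a), fun a ha => huniq a (hsub ha), ?_⟩
  · intro a b
    have := hG.2 _ (hT a) _ (hT b)
    simp only at this
    have e : a - T a - (b - T b) = (a - b) - (T a - T b) := by abel
    rw [e, inner_sub_right, real_inner_self_eq_norm_sq, real_inner_comm] at this
    linarith
  · intro w μ hμ
    obtain ⟨y, hy⟩ := key w μ hμ
    refine ⟨y, ⟨_, huniq _ hy⟩, fun a ha => ?_⟩
    have := hG.2 _ hy a (hsub ha)
    simp only at this
    rw [← neg_sub (μ • (w - y)), inner_neg_right]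
    linarith

end helpers

lemma aux_num (a b σ : ℝ) (ha : 0 < a) (hb : 0 < b) (hσ : 0 < σ)
    (h : 1 / a + 64 * σ ≤ 1 / b) : Real.exp (-(2 * a * σ)) + Real.exp (2 * b * σ) ≤ 2 := by
  have h1 : b * (1 + 64 * a * σ) ≤ a := by
    have := mul_le_mul_of_nonneg_left h (mul_pos ha hb).le
    have e1 : a * b * (1 / a + 64 * σ) = b * (1 + 64 * a * σ) := by field_simp
    have e2 : a * b * (1 / b) = a := by field_simp
    linarith
  set y := 2 * a * σ with hy
  set z := 2 * b * σ with hz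
  have hy0 : 0 < y := by positivity
  have hz0 : 0 < z := by positivity
  have h2 : z + 32 * (y * z) ≤ y := by
    have := mul_le_mul_of_nonneg_left h1 hσ.le
    rw [hy, hz]; nlinarith
  have hz1 : z < 1 := by
    by_contra hh; push Not at hh
    nlinarith
  have e1 : Real.exp (-y) ≤ 1 / (1 + y) := by
    rw [Real.exp_neg, ← one_div]
    exact one_div_le_one_div_of_le (by linarith) (by linarith [Real.add_one_le_exp y])
  have e2 : Real.exp z ≤ 1 / (1 - z) := by
    have := Real.add_one_le_exp (-z)
    rw [Real.exp_neg] at this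
    rw [le_div_iff₀ (by linarith)]
    have h3 : 1 - z ≤ (Real.exp z)⁻¹ := by linarith
    calc Real.exp z * (1 - z) ≤ Real.exp z * (Real.exp z)⁻¹ := by gcongr
      _ = 1 := mul_inv_cancel₀ (Real.exp_pos z).ne'
  have e3 : 1 / (1 + y) + 1 / (1 - z) ≤ 2 := by
    rw [div_add_div _ _ (by linarith) (by linarith), div_le_iff₀ (by nlinarith)]
    nlinarith
  linarith

lemma weak_zero {X : Type*} [NormedAddCommGroup X] [InnerProductSpace ℝ X] [CompleteSpace X]
    (x : ℕ → X) (hb : ∀ n, ‖x n‖ ≤ 1)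
    (h : ∀ m, Tendsto (fun n => ⟪x n, x m⟫) atTop (nhds 0)) (y : X) :
    Tendsto (fun n => ⟪x n, y⟫) atTop (nhds 0) := by
  set V := (Submodule.span ℝ (Set.range x)).topologicalClosure with hV
  haveI : CompleteSpace V := (Submodule.isClosed_topologicalClosure _).completeSpace_coe
  have h1 : ∀ z ∈ Submodule.span ℝ (Set.range x), Tendsto (fun n => ⟪x n, z⟫) atTop (nhds 0) := by
    intro z hz
    induction hz using Submodule.span_induction with
    | mem z hz => obtain ⟨m, rfl⟩ := hz; exact h m
    | zero => simp
    | add a b _ _ ha hb => simpa [inner_add_right] using ha.add hb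
    | smul c a _ ha => simpa [inner_smul_right] using ha.const_mul c
  have h2 : ∀ z ∈ V, Tendsto (fun n => ⟪x n, z⟫) atTop (nhds 0) := by
    intro z hz
    have hz' : z ∈ closure (Submodule.span ℝ (Set.range x) : Set X) := hz
    rw [Metric.tendsto_atTop]
    intro e he
    obtain ⟨v, hv, hvz⟩ := Metric.mem_closure_iff.1 hz' (e / 2) (by linarith)
    obtain ⟨N, hN⟩ := Metric.tendsto_atTop.1 (h1 v hv) (e / 2) (by linarith)
    refine ⟨N, fun n hn => ?_⟩
    have a1 := hN n hn
    rw [Real.dist_eq, sub_zero] at a1 ⊢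
    have a2 : |⟪x n, z - v⟫| ≤ e / 2 := by
      refine (abs_real_inner_le_norm _ _).trans ?_
      rw [dist_eq_norm] at hvz
      nlinarith [hb n, norm_nonneg (x n), norm_nonneg (z - v)]
    have a3 : ⟪x n, z⟫ = ⟪x n, v⟫ + ⟪x n, z - v⟫ := by rw [inner_sub_right]; ring
    rw [a3]
    exact (abs_add_le _ _).trans_lt (by linarith)
  obtain ⟨a, ha, b, hb', rfl⟩ := V.exists_add_mem_mem_orthogonal y
  have : ∀ n, ⟪x n, a + b⟫ = ⟪x n, a⟫ := by
    intro n
    rw [inner_add_right, (Submodule.mem_orthogonal _ _).1 hb' (x n)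
      (Submodule.le_topologicalClosure _ (Submodule.subset_span ⟨n, rfl⟩)), add_zero]
  simp only [this]
  exact h2 a ha


theorem exists_firmly_nonexpansive_weak_not_strong {X : Type*} [NormedAddCommGroup X] [InnerProductSpace ℝ X] [CompleteSpace X]
    (u : ℝ → X)
    (hu : ∀ s : ℝ, 0 ≤ s → ∀ t : ℝ, 0 ≤ t → ⟪u s, u t⟫ = Real.exp (-(s - t) ^ 2))
    (d : ℕ → ℝ) (hd : IsMesh d)
    (t : ℕ → ℝ) (ht : ∀ n, t n = ∑ k ∈ Finset.Ico 1 n, d k)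
    (ρ : ℕ → ℝ) (hρ : ∀ n, ρ n = Real.exp (-(∑ k ∈ Finset.Ico 1 n, d k ^ 2)))
    (x : ℕ → X) (hx : ∀ n, x n = ρ n • u (t n)) :
    ∃ T : X → X,
      (∀ a b : X, ‖T a - T b‖ ^ 2 ≤ ⟪a - b, T a - T b⟫) ∧
      closure (Set.range T) =
        closure (convexHull ℝ {y : X | ∃ n : ℕ, 2 ≤ n ∧ y = x n}) ∧
      {a : X | T a = a} = {0} ∧
      (∀ n : ℕ, 1 ≤ n → T (x n) = x (n + 1)) ∧
      (∀ y : X, Tendsto (fun n : ℕ => ⟪T^[n] (x 1), y⟫) atTop (nhds 0)) ∧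
      (⨅ n : ℕ, ‖T^[n + 1] (x 1)‖) = Real.exp (-∑' k : ℕ, d (k + 1) ^ 2) ∧
      0 < Real.exp (-∑' k : ℕ, d (k + 1) ^ 2) := by
  obtain ⟨dpos, dsum, ttop, -, dstep⟩ := hd
  have ht' : ∀ n, 1 ≤ n → t (n + 1) = t n + d n := by
    intro n hn; rw [ht, ht, Finset.sum_Ico_succ_top hn]
  have hρ' : ∀ n, 1 ≤ n → ρ n = ρ (n + 1) * Real.exp (d n ^ 2) := by
    intro n hn; rw [hρ, hρ, Finset.sum_Ico_succ_top hn, ← Real.exp_add]; congr 1; ring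
  have t0 : ∀ n, 0 ≤ t n := by
    intro n; rw [ht]
    exact Finset.sum_nonneg fun k hk => (dpos k (Finset.mem_Ico.1 hk).1).le
  have ρ0 : ∀ n, 0 < ρ n := by intro n; rw [hρ]; exact Real.exp_pos _
  have ρ1 : ∀ n, ρ n ≤ 1 := by
    intro n; rw [hρ, Real.exp_le_one_iff, neg_nonpos]
    exact Finset.sum_nonneg fun k hk => sq_nonneg _
  have hin : ∀ m n, ⟪x m, x n⟫ = ρ m * ρ n * Real.exp (-(t m - t n) ^ 2) := by
    intro m n
    rw [hx, hx, inner_smul_left, inner_smul_right, hu _ (t0 m) _ (t0 n)]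
    simp only [RCLike.conj_to_real]; ring
  have hnorm : ∀ n, ‖x n‖ = ρ n := by
    intro n
    have := hin n n
    rw [real_inner_self_eq_norm_sq] at this
    simp only [sub_self, ne_eq, OfNat.ofNat_ne_zero, not_false_eq_true, zero_pow, neg_zero,
      Real.exp_zero, mul_one] at this
    rw [← sq] at this
    exact (sq_eq_sq₀ (norm_nonneg _) (ρ0 n).le).1 this
  have hnorm1 : ∀ n, ‖x n‖ ≤ 1 := fun n => (hnorm n).trans_le (ρ1 n)
  -- weak convergence
  have hweak : ∀ y, Tendsto (fun n => ⟪x n, y⟫) atTop (nhds 0) := by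
    apply weak_zero x hnorm1
    intro m
    have hT : Tendsto t atTop atTop := by
      have : t = fun n => ∑ k ∈ Finset.Ico 1 n, d k := funext ht
      rw [this]; exact ttop
    have h1 : Tendsto (fun n => t n - t m) atTop atTop :=
      tendsto_atTop_add_const_right _ (-(t m)) hT
    have h2 : Tendsto (fun n => Real.exp (-(t n - t m) ^ 2)) atTop (nhds 0) :=
      Real.tendsto_exp_neg_atTop_nhds_zero.comp ((tendsto_pow_atTop two_ne_zero).comp h1)
    refine squeeze_zero (fun n => ?_) (fun n => ?_) h2
    · rw [hin]; have := ρ0 n; have := ρ0 m; positivity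
    · rw [hin]
      exact mul_le_of_le_one_left (Real.exp_pos _).le
        (mul_le_one₀ (ρ1 n) (ρ0 m).le (ρ1 m))
  -- orthogonality
  have horth : ∀ n, 1 ≤ n → ⟪x (n + 1), x n - x (n + 1)⟫ = 0 := by
    intro n hn
    rw [inner_sub_right, hin, hin, ht' n hn, hρ' n hn]
    have : Real.exp (d n ^ 2) * Real.exp (-(t n + d n - t n) ^ 2) = 1 := by
      rw [← Real.exp_add]; simp
    simp only [sub_self, ne_eq, OfNat.ofNat_ne_zero, not_false_eq_true, zero_pow, neg_zero,
      Real.exp_zero, mul_one]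
    linear_combination ρ (n+1) * ρ (n+1) * this
  -- mesh
  have hmesh : ∀ n, 1 ≤ n → ∀ m, n ≤ m → 1 / d n + 64 * (t m - t n) ≤ 1 / d m ∧ d m ≤ d n := by
    intro n hn m hm
    induction m, hm using Nat.le_induction with
    | base => simp
    | succ k hk ih =>
      have hk1 : 1 ≤ k := hn.trans hk
      have p := dpos k hk1
      have p' := dpos (k + 1) (by omega)
      have s := dstep k hk1
      constructor
      · have : 1 / d k + 64 * d k ≤ 1 / d (k + 1) := by
          have h1 := one_div_le_one_div_of_le p' s
          have e : 1 / (d k / (1 + 64 * d k ^ 2)) = 1 / d k + 64 * d k := by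
            field_simp
          linarith
        rw [ht' k hk1]; linarith [ih.1]
      · have : d k / (1 + 64 * d k ^ 2) ≤ d k := div_le_self p.le (by nlinarith)
        linarith [ih.2]
  have hmono1 : ∀ n, 1 ≤ n → ∀ m, n < m →
      0 ≤ ⟪x (n + 1) - x (m + 1), (x n - x (n + 1)) - (x m - x (m + 1))⟫ := by
    intro n hn m hm
    have hm1 : 1 ≤ m := by omega
    have e : ⟪x (n + 1) - x (m + 1), (x n - x (n + 1)) - (x m - x (m + 1))⟫
        = 2 * ⟪x (n + 1), x (m + 1)⟫ - ⟪x n, x (m + 1)⟫ - ⟪x m, x (n + 1)⟫ := by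
      have o1 := horth n hn
      have o2 := horth m hm1
      rw [inner_sub_right] at o1 o2
      simp only [inner_sub_left, inner_sub_right]
      rw [real_inner_comm (x (n+1)) (x (m+1)), real_inner_comm (x n) (x (m+1)),
        real_inner_comm (x m) (x (n+1))] at *
      linarith
    rw [e]
    obtain ⟨h1, h2⟩ := hmesh n hn m hm.le
    obtain ⟨h3, -⟩ := hmesh n hn m hm.le
    have hσ : 0 < t (m + 1) - t (n + 1) := by
      have : t (n + 1) ≤ t m := by
        rw [ht, ht]
        refine Finset.sum_le_sum_of_subset_of_nonneg (Finset.Ico_subset_Ico le_rfl hm) ?_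
        intro k hk _; exact (dpos k (Finset.mem_Ico.1 hk).1).le
      rw [ht' m hm1]; linarith [dpos m hm1]
    set σ := t (m + 1) - t (n + 1) with hσd
    have num := aux_num (d n) (d m) σ (dpos n hn) (dpos m hm1) hσ (by
      have := ht' n hn; have := ht' m hm1; linarith)
    have en : t n - t (m + 1) = -(σ + d n) := by rw [hσd, ht' n hn]; ring
    have em : t m - t (n + 1) = σ - d m := by rw [hσd, ht' m hm1]; ring
    have e0 : t (n + 1) - t (m + 1) = -σ := by rw [hσd]; ring
    rw [hin, hin, hin, en, em, e0, hρ' n hn, hρ' m hm1]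
    have E1 : Real.exp (d n ^ 2) * Real.exp (-(-(σ + d n)) ^ 2)
        = Real.exp (-(-σ) ^ 2) * Real.exp (-(2 * d n * σ)) := by
      rw [← Real.exp_add, ← Real.exp_add]; congr 1; ring
    have E2 : Real.exp (d m ^ 2) * Real.exp (-(σ - d m) ^ 2)
        = Real.exp (-(-σ) ^ 2) * Real.exp (2 * d m * σ) := by
      rw [← Real.exp_add, ← Real.exp_add]; congr 1; ring
    have hpos : 0 ≤ ρ (n + 1) * ρ (m + 1) * Real.exp (-(-σ) ^ 2) := by
      have := ρ0 (n + 1); have := ρ0 (m + 1); positivity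
    have := mul_nonneg hpos (sub_nonneg.2 num)
    refine this.trans_eq ?_
    linear_combination (ρ (n+1) * ρ (m+1)) * E1 + (ρ (n+1) * ρ (m+1)) * E2
  set A : Set X := {y : X | ∃ n : ℕ, 2 ≤ n ∧ y = x n} with hA
  set C : Set X := closure (convexHull ℝ A) with hC
  have hCconv : Convex ℝ C := (convex_convexHull ℝ A).closure
  have hCcl : IsClosed C := isClosed_closure
  have hCmin : ∀ S : Set X, Convex ℝ S → IsClosed S → (∀ n, 1 ≤ n → x (n + 1) ∈ S) → C ⊆ S := by
    intro S h1 h2 h3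
    refine closure_minimal (convexHull_min ?_ h1) h2
    rintro y ⟨n, hn, rfl⟩
    obtain ⟨k, rfl⟩ : ∃ k, n = k + 1 := ⟨n - 1, by omega⟩
    exact h3 k (by omega)
  have hxC : ∀ n, 1 ≤ n → x (n + 1) ∈ C := fun n hn =>
    subset_closure (subset_convexHull ℝ A ⟨n + 1, by omega, rfl⟩)
  have hR : C ⊆ Metric.closedBall 0 1 :=
    hCmin _ (convex_closedBall 0 1) Metric.isClosed_closedBall fun n _ => by
      simpa using hnorm1 (n + 1)
  have h0C : (0 : X) ∈ C := by
    by_contra h0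
    obtain ⟨g, c, hg1, hg2⟩ := geometric_hahn_banach_closed_point hCconv hCcl h0
    rw [map_zero] at hg2
    have hl := (hweak ((InnerProductSpace.toDual ℝ X).symm g)).comp (tendsto_add_atTop_nat 2)
    have : (0 : ℝ) ≤ c := by
      refine le_of_tendsto hl (Eventually.of_forall fun n => ?_)
      simp only [Function.comp]
      rw [real_inner_comm, InnerProductSpace.toDual_symm_apply]
      exact (hg1 _ (hxC (n + 1) (by omega))).le
    linarith
  set G0 : Set (X × X) :=
    insert (0, 0) {a | ∃ n, 1 ≤ n ∧ a = (x (n + 1), x n - x (n + 1))} with hG0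
  have hG : MonoSet C G0 := by
    constructor
    · rintro a (rfl | ⟨n, hn, rfl⟩)
      · exact h0C
      · exact hxC n hn
    · rintro a (rfl | ⟨n, hn, rfl⟩) b (rfl | ⟨m, hm, rfl⟩)
      · simp
      · simp only [zero_sub, inner_neg_neg]; rw [horth m hm]
      · simp only [sub_zero]; rw [horth n hn]
      · rcases lt_trichotomy n m with h | rfl | h
        · exact hmono1 n hn m h
        · simp
        · have := hmono1 m hm n h
          rw [← neg_sub, ← neg_sub (x n - x (n + 1)), inner_neg_neg] at this
          exact this
  obtain ⟨T, hfirm, hTC, hTG, hTd⟩ := firm_ext hCconv hCcl ⟨0, h0C⟩ 1 hR hG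
  have hTx : ∀ n, 1 ≤ n → T (x n) = x (n + 1) := by
    intro n hn
    have := hTG (x (n + 1), x n - x (n + 1)) (Or.inr ⟨n, hn, rfl⟩)
    simpa using this
  have hT0 : T 0 = 0 := by
    have := hTG (0, 0) (Or.inl rfl)
    simpa using this
  have hit : ∀ n, T^[n] (x 1) = x (n + 1) := by
    intro n
    induction n with
    | zero => rfl
    | succ k ih => rw [Function.iterate_succ_apply', ih, hTx _ (by omega)]
  refine ⟨T, hfirm, ?_, ?_, hTx, ?_, ?_, Real.exp_pos _⟩
  · apply Set.Subset.antisymm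
    · refine closure_minimal ?_ hCcl
      rintro _ ⟨a, rfl⟩; exact hTC a
    · intro w hw
      rw [Metric.mem_closure_iff]
      intro e he
      have hμ : 0 < 8 / e ^ 2 := by positivity
      obtain ⟨y, hyr, hy⟩ := hTd w (8 / e ^ 2) hμ
      refine ⟨y, hyr, ?_⟩
      have hy1 : ‖y‖ ≤ 1 := by
        obtain ⟨a, rfl⟩ := hyr
        simpa using hR (hTC a)
      have hsub : C ⊆ {p : X | ⟪p - y, w - y⟫ ≤ 4 / (8 / e ^ 2)} := by
        apply hCmin
        · intro p hp p' hp' a b ha hb hab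
          simp only [Set.mem_ofPred_eq] at hp hp' ⊢
          have : a • p + b • p' - y = a • (p - y) + b • (p' - y) := by
            obtain rfl : b = 1 - a := by linarith
            module
          rw [this, inner_add_left, inner_smul_left, inner_smul_left]
          simp only [RCLike.conj_to_real]
          calc _ ≤ a * (4 / (8 / e ^ 2)) + b * (4 / (8 / e ^ 2)) := by gcongr
            _ = (4 / (8 / e ^ 2)) := by rw [← add_mul, hab, one_mul]
        · exact isClosed_le (by fun_prop) continuous_const
        · intro n hn
          have h1 := hy (x (n + 1), x n - x (n + 1)) (Or.inr ⟨n, hn, rfl⟩)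
          simp only [inner_sub_right (y - x (n + 1)) (x n - x (n + 1)), inner_smul_right] at h1
          have h2 : |⟪y - x (n + 1), x n - x (n + 1)⟫| ≤ 2 * 2 := by
            refine (abs_real_inner_le_norm _ _).trans ?_
            refine mul_le_mul ?_ ?_ (norm_nonneg _) (by norm_num)
            · exact (norm_sub_le _ _).trans (by linarith [hnorm1 (n + 1)])
            · exact (norm_sub_le _ _).trans (by linarith [hnorm1 (n + 1), hnorm1 n])
          have h3 := (abs_le.1 h2).1
          rw [Set.mem_ofPred_eq, ← neg_sub y, inner_neg_left, le_div_iff₀ hμ]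
          linarith
      have := hsub hw
      rw [Set.mem_ofPred_eq, real_inner_self_eq_norm_sq] at this
      have e4 : 4 / (8 / e ^ 2) = e ^ 2 / 2 := by field_simp; norm_num
      rw [e4] at this
      rw [dist_eq_norm]
      nlinarith [norm_nonneg (w - y)]
  · ext p
    simp only [Set.mem_ofPred_eq, Set.mem_singleton_iff]
    constructor
    · intro hp
      have hpC : p ∈ C := hp ▸ hTC p
      have hstep : ∀ n, 1 ≤ n → ⟪x n, p⟫ ≤ ⟪x (n + 1), p⟫ := by
        intro n hn
        have h1 := hfirm (x n) p
        rw [hTx n hn, hp, ← real_inner_self_eq_norm_sq] at h1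
        have o := horth n hn
        simp only [inner_sub_left, inner_sub_right] at h1 o
        rw [real_inner_comm (x n) (x (n + 1)), real_inner_comm p (x (n+1))] at *
        linarith
      have hmon : Monotone (fun k => ⟪x (k + 1), p⟫) :=
        monotone_nat_of_le_succ fun k => hstep (k + 1) (by omega)
      have hle : ∀ k, ⟪x (k + 1), p⟫ ≤ 0 := fun k =>
        hmon.ge_of_tendsto ((hweak p).comp (tendsto_add_atTop_nat 1)) k
      have hsub : C ⊆ {y : X | ⟪y, p⟫ ≤ 0} := by
        apply hCmin
        · intro y hy z hz a b ha hb hab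
          simp only [Set.mem_ofPred_eq] at hy hz ⊢
          rw [inner_add_left, inner_smul_left, inner_smul_left]
          simp only [RCLike.conj_to_real]
          nlinarith
        · exact isClosed_le (by fun_prop) continuous_const
        · intro n _; exact hle n
      exact inner_self_eq_zero (𝕜 := ℝ).1 (le_antisymm (hsub hpC) real_inner_self_nonneg)
    · rintro rfl; exact hT0
  · intro y
    simp only [hit]
    exact (hweak y).comp (tendsto_add_atTop_nat 1)
  · have hform : ∀ n, ‖T^[n + 1] (x 1)‖ = Real.exp (-∑ k ∈ Finset.range (n + 1), d (k + 1) ^ 2) := by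
      intro n
      rw [hit, hnorm, hρ, Finset.sum_Ico_eq_sum_range]
      simp [add_comm]
    simp only [hform]
    have hanti : Antitone fun n : ℕ => Real.exp (-∑ k ∈ Finset.range (n + 1), d (k + 1) ^ 2) := by
      refine antitone_nat_of_succ_le fun n => ?_
      rw [Real.exp_le_exp, neg_le_neg_iff, Finset.sum_range_succ _ (n + 1)]
      nlinarith [sq_nonneg (d (n + 1 + 1))]
    have hlim : Tendsto (fun n : ℕ => Real.exp (-∑ k ∈ Finset.range (n + 1), d (k + 1) ^ 2)) atTop
        (nhds (Real.exp (-∑' k : ℕ, d (k + 1) ^ 2))) :=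
      (Real.continuous_exp.tendsto _).comp
        ((dsum.hasSum.tendsto_sum_nat.comp (tendsto_add_atTop_nat 1)).neg)
    exact tendsto_nhds_unique (tendsto_atTop_ciInf hanti
      ⟨0, by rintro _ ⟨n, rfl⟩; exact (Real.exp_pos _).le⟩) hlim
end

section
/- Let X be an infinite-dimensional real Hilbert space. Then there exist a firmly nonexpansive map T : X → X (i.e., ‖T a − T b‖^2 ≤ ⟨a − b, T a − T b⟩ for all a, b ∈ X) whose fixed point set is exactly {0}, and a point x_1 ∈ X, such that the Cesàro means y_n := (1/n) ∑_{k=1}^n T^{k-1} x_1 satisfy: y_n converges weakly to 0 (i.e., ⟨y_n, z⟩ → 0 for every z ∈ X), liminf_{n→∞} ‖y_n‖ = 0, and limsup_{n→∞} ‖y_n‖ > 0; in particular the Cesàro means do not converge strongly. -/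
open Filter
open scoped RealInnerProductSpace

theorem kirs_one_point {X : Type*} [NormedAddCommGroup X] [InnerProductSpace ℝ X] [CompleteSpace X]
    (A : Set (X × X)) (h : ∀ p ∈ A, ∀ q ∈ A, ‖p.2 - q.2‖ ≤ ‖p.1 - q.1‖) (x : X) :
    ∃ y : X, ∀ p ∈ A, ‖p.2 - y‖ ≤ ‖p.1 - x‖ := by
  rcases A.eq_empty_or_nonempty with rfl | ⟨p₀, hp₀⟩
  · exact ⟨0, by simp⟩
  let f : X × X → X × X × ℝ := fun p => (p.1 - x, p.2, ‖p.2‖ ^ 2 - ‖p.1 - x‖ ^ 2)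
  let C : Set (X × X × ℝ) := convexHull ℝ (f '' A)
  have hCc : Convex ℝ C := convex_convexHull ℝ _
  have hfC : ∀ p ∈ A, f p ∈ C := fun p hp => subset_convexHull ℝ _ ⟨p, hp, rfl⟩
  -- the bilinear form
  let B : X × X × ℝ → X × X × ℝ → ℝ := fun q r =>
    2 * ⟪q.2.1, r.2.1⟫ - q.2.2 - r.2.2 - 2 * ⟪q.1, r.1⟫
  have hBconv : ∀ r, Convex ℝ {q | 0 ≤ B q r} := by
    intro r q hq q' hq' a b ha hb hab
    simp only [Set.mem_ofPred_eq, B] at hq hq' ⊢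
    simp only [Prod.fst_add, Prod.snd_add, Prod.smul_fst, Prod.smul_snd, inner_add_left,
      inner_smul_left, smul_eq_mul, RCLike.conj_to_real]
    have hb' : b = 1 - a := by linarith
    have h1 := mul_nonneg ha hq
    have h2 := mul_nonneg hb hq'
    subst hb'
    nlinarith
  have hBsymm : ∀ q r, B q r = B r q := by
    intro q r
    simp only [B]
    rw [real_inner_comm r.2.1, real_inner_comm r.1]
    ring
  have hB0 : ∀ p ∈ A, ∀ q ∈ A, 0 ≤ B (f p) (f q) := by
    intro p hp q hq
    simp only [B, f]
    have h1 := h p hp q hq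
    have h2 : ‖p.2 - q.2‖ ^ 2 ≤ ‖(p.1 - x) - (q.1 - x)‖ ^ 2 := by
      rw [sub_sub_sub_cancel_right]
      gcongr
    rw [norm_sub_sq_real, norm_sub_sq_real] at h2
    linarith
  have hB1 : ∀ p ∈ A, ∀ q ∈ C, 0 ≤ B q (f p) := by
    intro p hp
    apply convexHull_min _ (hBconv (f p))
    rintro _ ⟨q, hq, rfl⟩
    exact hB0 q hq p hp
  have hB2 : ∀ q ∈ C, ∀ r ∈ C, 0 ≤ B r q := by
    intro q hq
    apply convexHull_min _ (hBconv q)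
    rintro _ ⟨p, hp, rfl⟩
    show 0 ≤ B (f p) q
    rw [hBsymm]
    exact hB1 p hp q hq
  let G : X × X × ℝ → ℝ := fun q => q.2.2 - ‖q.2.1‖ ^ 2
  have hG0 : ∀ q ∈ C, G q ≤ 0 := by
    intro q hq
    have := hB2 q hq q hq
    simp only [B, real_inner_self_eq_norm_sq] at this
    simp only [G]
    nlinarith [sq_nonneg ‖q.1‖]
  have hGid : ∀ (q r : X × X × ℝ) (t : ℝ), G ((1 - t) • q + t • r)
      = (1 - t) * G q + t * G r + t * (1 - t) * ‖q.2.1 - r.2.1‖ ^ 2 := by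
    intro q r t
    simp only [G, Prod.fst_add, Prod.snd_add, Prod.smul_fst, Prod.smul_snd, smul_eq_mul]
    rw [norm_sub_sq_real, norm_add_sq_real, norm_smul, norm_smul, inner_smul_left,
      inner_smul_right, mul_pow, mul_pow, Real.norm_eq_abs, Real.norm_eq_abs, sq_abs, sq_abs]
    simp only [RCLike.conj_to_real]
    ring
  have hne : (G '' C).Nonempty := ⟨_, _, hfC p₀ hp₀, rfl⟩
  have hbdd : BddAbove (G '' C) := ⟨0, by rintro _ ⟨q, hq, rfl⟩; exact hG0 q hq⟩
  set M := sSup (G '' C) with hM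
  have hM0 : M ≤ 0 := csSup_le hne (by rintro _ ⟨q, hq, rfl⟩; exact hG0 q hq)
  have hGM : ∀ q ∈ C, G q ≤ M := fun q hq => le_csSup hbdd ⟨q, hq, rfl⟩
  have hex : ∀ n : ℕ, ∃ q ∈ C, M - 1 / ((n : ℝ) + 1) < G q := by
    intro n
    have hlt : M - 1 / ((n : ℝ) + 1) < M := by
      have : (0 : ℝ) < 1 / ((n : ℝ) + 1) := by positivity
      linarith
    obtain ⟨_, ⟨q, hq, rfl⟩, hlt'⟩ := exists_lt_of_lt_csSup hne hlt
    exact ⟨q, hq, hlt'⟩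
  choose c hcC hcG using hex
  have hcv : ∀ q ∈ C, ∀ r ∈ C, ∀ t : ℝ, 0 ≤ t → t ≤ 1 → (1 - t) • q + t • r ∈ C := by
    intro q hq r hr t ht0 ht1
    exact hCc hq hr (by linarith) ht0 (by ring)
  have hcauchy : CauchySeq (fun n => (c n).2.1) := by
    refine cauchySeq_of_le_tendsto_0 (fun N : ℕ => Real.sqrt (4 * (1 / ((N : ℝ) + 1)))) ?_ ?_
    · intro n m N hn hm
      rw [dist_eq_norm]
      apply Real.le_sqrt_of_sq_le
      have h1 := hGM _ (hcv _ (hcC n) _ (hcC m) (1 / 2) (by norm_num) (by norm_num))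
      rw [hGid] at h1
      have h2 := hcG n
      have h3 := hcG m
      have h4 : 1 / ((n : ℝ) + 1) ≤ 1 / ((N : ℝ) + 1) := by
        gcongr
      have h5 : 1 / ((m : ℝ) + 1) ≤ 1 / ((N : ℝ) + 1) := by
        gcongr
      linarith
    · have := (tendsto_one_div_add_atTop_nhds_zero_nat (𝕜 := ℝ)).const_mul 4
      have := (Real.continuous_sqrt.tendsto _).comp this
      rw [mul_zero, Real.sqrt_zero] at this
      exact this
  obtain ⟨y, hy⟩ := cauchySeq_tendsto_of_complete hcauchy
  have hGl : Tendsto (fun n => G (c n)) atTop (nhds M) := by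
    refine tendsto_of_tendsto_of_tendsto_of_le_of_le (g := fun n : ℕ => M - 1 / ((n : ℝ) + 1))
      (h := fun _ => M) ?_ tendsto_const_nhds (fun n => (hcG n).le) (fun n => hGM _ (hcC n))
    have := (tendsto_one_div_add_atTop_nhds_zero_nat (𝕜 := ℝ)).const_sub M
    simpa using this
  refine ⟨y, fun p hp => ?_⟩
  have key : ∀ t : ℝ, 0 < t → t ≤ 1 → G (f p) + (1 - t) * ‖y - p.2‖ ^ 2 ≤ M := by
    intro t ht0 ht1
    have h1 : ∀ n, (1 - t) * G (c n) + t * G (f p) + t * (1 - t) * ‖(c n).2.1 - p.2‖ ^ 2 ≤ M := by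
      intro n
      have := hGM _ (hcv _ (hcC n) _ (hfC p hp) t ht0.le ht1)
      rwa [hGid] at this
    have h2 : Tendsto (fun n => (1 - t) * G (c n) + t * G (f p)
        + t * (1 - t) * ‖(c n).2.1 - p.2‖ ^ 2) atTop
        (nhds ((1 - t) * M + t * G (f p) + t * (1 - t) * ‖y - p.2‖ ^ 2)) :=
      ((hGl.const_mul _).add_const _).add ((((hy.sub_const _).norm).pow 2).const_mul _)
    have h3 := le_of_tendsto' h2 h1
    have h4 : t * (G (f p) + (1 - t) * ‖y - p.2‖ ^ 2) ≤ t * M := by linarith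
    exact le_of_mul_le_mul_left h4 ht0
  have key2 : G (f p) + ‖y - p.2‖ ^ 2 ≤ M := by
    apply le_of_forall_pos_le_add
    intro ε hε
    let D := ‖y - p.2‖ ^ 2
    have hD : 0 ≤ D := sq_nonneg _
    have ht : 0 < min 1 (ε / (D + 1)) := lt_min one_pos (by positivity)
    have h1 := key _ ht (min_le_left _ _)
    have h2 : min 1 (ε / (D + 1)) * D ≤ ε := by
      calc min 1 (ε / (D + 1)) * D ≤ ε / (D + 1) * (D + 1) :=
            mul_le_mul (min_le_right _ _) (by linarith) hD (by positivity)
        _ = ε := by field_simp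
    change G (f p) + (1 - min 1 (ε / (D + 1))) * D ≤ M at h1
    change G (f p) + D ≤ M + ε
    linarith
  have h5 : ‖p.2 - y‖ ^ 2 ≤ ‖p.1 - x‖ ^ 2 := by
    rw [norm_sub_rev p.2 y]
    have : G (f p) = -‖p.1 - x‖ ^ 2 := by simp only [G, f]; ring
    rw [this] at key2
    linarith
  exact (pow_le_pow_iff_left₀ (norm_nonneg _) (norm_nonneg _) two_ne_zero).1 h5

theorem kirs_extension {X : Type*} [NormedAddCommGroup X] [InnerProductSpace ℝ X] [CompleteSpace X]
    (A : Set (X × X)) (h : ∀ p ∈ A, ∀ q ∈ A, ‖p.2 - q.2‖ ≤ ‖p.1 - q.1‖) :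
    ∃ N : X → X, (∀ a b, ‖N a - N b‖ ≤ ‖a - b‖) ∧ ∀ p ∈ A, N p.1 = p.2 := by
  let F : Set (Set (X × X)) := {A | ∀ p ∈ A, ∀ q ∈ A, ‖p.2 - q.2‖ ≤ ‖p.1 - q.1‖}
  obtain ⟨Mx, hAM, hmax⟩ := zorn_subset_nonempty F (by
    intro c hc hch hcne
    refine ⟨⋃₀ c, ?_, fun s hs => Set.subset_sUnion_of_mem hs⟩
    rintro p ⟨s, hs, hp⟩ q ⟨t, ht, hq⟩
    rcases hch.total hs ht with hst | hst
    · exact hc ht p (hst hp) q hq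
    · exact hc hs p hp q (hst hq)) A h
  have hMF : Mx ∈ F := hmax.prop
  have hall : ∀ x, ∃ y, (x, y) ∈ Mx := by
    intro x
    obtain ⟨y, hy⟩ := kirs_one_point Mx hMF x
    refine ⟨y, ?_⟩
    have hins : insert (x, y) Mx ∈ F := by
      rintro p (rfl | hp) q (rfl | hq)
      · simp
      · rw [norm_sub_rev, norm_sub_rev x]
        exact hy q hq
      · exact hy p hp
      · exact hMF p hp q hq
    exact hmax.le_of_ge hins (Set.subset_insert _ _) (Set.mem_insert _ _)
  choose N hN using hall
  refine ⟨N, fun a b => hMF _ (hN a) _ (hN b), fun p hp => ?_⟩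
  have := hMF _ (hN p.1) _ (hAM hp)
  simp only [sub_self, norm_zero] at this
  exact sub_eq_zero.1 (norm_le_zero_iff.1 this)


/-- isometry with a unit vector orthogonal to the range -/
theorem exists_shift {X : Type*} [NormedAddCommGroup X] [InnerProductSpace ℝ X] [CompleteSpace X]
    (hX : ¬ FiniteDimensional ℝ X) :
    ∃ (S : X →L[ℝ] X) (e : X), (∀ a b, ⟪S a, S b⟫ = ⟪a, b⟫) ∧ ‖e‖ = 1 ∧ ∀ a, ⟪e, S a⟫ = 0 := by
  obtain ⟨w, b, hb⟩ := exists_hilbertBasis ℝ X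
  have hinf : Infinite w := by
    by_contra hfin
    rw [not_infinite_iff_finite] at hfin
    have := Fintype.ofFinite w
    exact hX (Module.Basis.finiteDimensional_of_finite b.toOrthonormalBasis.toBasis)
  obtain ⟨g⟩ : Nonempty (Option w ≃ w) := by
    rw [← Cardinal.eq, Cardinal.mk_option]
    exact Cardinal.add_one_eq (Cardinal.aleph0_le_mk w)
  have hf : Function.Injective (fun i : w => g (some i)) :=
    g.injective.comp (Option.some_injective w)
  have hon : Orthonormal ℝ (fun i : w => b (g (some i))) := b.orthonormal.comp _ hf
  let L := hon.orthogonalFamily.linearIsometry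
  refine ⟨(L.comp b.repr.toLinearIsometry).toContinuousLinearMap, b (g none), ?_, ?_, ?_⟩
  · intro x y
    exact (L.comp b.repr.toLinearIsometry).inner_map_map x y
  · exact b.orthonormal.1 _
  · intro x
    have hs := hon.orthogonalFamily.hasSum_linearIsometry (b.repr x)
    have hs2 := (innerSL ℝ (b (g none))).hasSum hs
    refine hs2.unique ?_
    have : (⇑(innerSL ℝ (b (g none))) ∘ fun i =>
        (LinearIsometry.toSpanSingleton ℝ X (hon.1 i)) ((b.repr x) i)) = fun _ => 0 := by
      funext i
      simp only [Function.comp, LinearIsometry.toSpanSingleton_apply, map_smul, innerSL_apply_apply]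
      rw [b.orthonormal.2 (fun h => by simpa using g.injective h), smul_zero]
    have h0 : HasSum (fun _ : w => (0 : ℝ)) 0 := hasSum_zero
    rw [← this] at h0
    exact h0

theorem exists_E {X : Type*} [NormedAddCommGroup X] [InnerProductSpace ℝ X] [CompleteSpace X]
    (S : X →L[ℝ] X) (hS : ∀ a b, ⟪S a, S b⟫ = ⟪a, b⟫) (d : ℝ) (h0 : 0 < d) (h1 : d ≤ 1) :
    ∃ E : X →L[ℝ] X, (∀ x, (1 + d) • E x + (1 - d) • S (E x) = (2 : ℝ) • x) ∧
      ∀ x, S (E x) = E (S x) := by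
  have hn : ‖S‖ ≤ 1 := by
    refine S.opNorm_le_bound zero_le_one fun x => ?_
    have := hS x x
    rw [real_inner_self_eq_norm_sq, real_inner_self_eq_norm_sq] at this
    rw [one_mul]
    exact ((pow_left_inj₀ (norm_nonneg _) (norm_nonneg _) two_ne_zero).1 this).le
  let r : ℝ := -((1 - d) / (1 + d))
  have hr : ‖r • S‖ < 1 := by
    rw [norm_smul, Real.norm_eq_abs, abs_neg, abs_of_nonneg (div_nonneg (by linarith) (by linarith))]
    have : (1 - d) / (1 + d) < 1 := by rw [div_lt_one (by linarith)]; linarith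
    have h2 : 0 ≤ (1 - d) / (1 + d) := div_nonneg (by linarith) (by linarith)
    nlinarith [norm_nonneg S]
  let u := Units.oneSub (r • S) hr
  have hu : (u : X →L[ℝ] X) = 1 - r • S := rfl
  have hcomm : Commute S (u : X →L[ℝ] X) := by
    rw [hu]
    exact (Commute.one_right S).sub_right ((Commute.refl S).smul_right r)
  have hcomm' : Commute S ((u⁻¹ : (X →L[ℝ] X)ˣ) : X →L[ℝ] X) := hcomm.units_inv_right
  refine ⟨(2 / (1 + d)) • ((u⁻¹ : (X →L[ℝ] X)ˣ) : X →L[ℝ] X), fun x => ?_, fun x => ?_⟩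
  · have h3 : (u : X →L[ℝ] X) (((u⁻¹ : (X →L[ℝ] X)ˣ) : X →L[ℝ] X) x) = x := by
      exact congrArg (fun L : X →L[ℝ] X => L x) u.mul_inv
    rw [hu] at h3
    set v := ((u⁻¹ : (X →L[ℝ] X)ˣ) : X →L[ℝ] X) x
    have h4 : v - r • S v = x := h3
    simp only [smul_apply, map_smul]
    change (1 + d) • (2 / (1 + d)) • v + (1 - d) • (2 / (1 + d)) • S v = _
    rw [← h4]
    have hd : (1 + d) ≠ 0 := by linarith
    simp only [r]
    match_scalars <;> field_simp
  · have := congrArg (fun L : X →L[ℝ] X => L x) hcomm'.eq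
    simp only [smul_apply, map_smul]
    congr 1

/-- orbit of a point under a sequence of maps -/
def orbSeq {X : Type*} (J : ℕ → X → X) (x : X) : ℕ → X
  | 0 => x
  | (k + 1) => J k (orbSeq J x k)

/-- `e` is approximately in the range of `1 - S`. -/
theorem approx_range {X : Type*} [NormedAddCommGroup X] [InnerProductSpace ℝ X]
    (S : X →L[ℝ] X) (hS : ∀ a b, ⟪S a, S b⟫ = ⟪a, b⟫) (e : X) (he : ‖e‖ = 1)
    (heS : ∀ a, ⟪e, S a⟫ = 0) (ε : ℝ) (hε : 0 < ε) :
    ∃ q r : X, e = q - S q + r ∧ ‖r‖ ≤ ε := by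
  -- partial geometric sums
  have hgeo : ∀ j : ℕ, e = (∑ i ∈ Finset.range j, S^[i] e) - S (∑ i ∈ Finset.range j, S^[i] e)
      + S^[j] e := by
    intro j
    induction j with
    | zero => simp
    | succ j ih =>
      rw [Finset.sum_range_succ, map_add, Function.iterate_succ_apply']
      nth_rewrite 1 [ih]
      abel
  have hn : ∀ a, ‖S a‖ = ‖a‖ := by
    intro a
    have := hS a a
    rw [real_inner_self_eq_norm_sq, real_inner_self_eq_norm_sq] at this
    exact (pow_left_inj₀ (norm_nonneg _) (norm_nonneg _) two_ne_zero).1 this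
  have hnj : ∀ j : ℕ, ‖S^[j] e‖ = 1 := by
    intro j
    induction j with
    | zero => simpa using he
    | succ j ih => rw [Function.iterate_succ_apply', hn, ih]
  -- sums
  have hsum : ∀ m : ℕ, ∃ q, (m : ℝ) • e = q - S q + ∑ j ∈ Finset.range m, S^[j] e := by
    intro m
    induction m with
    | zero => exact ⟨0, by simp⟩
    | succ m ih =>
      obtain ⟨q, hq⟩ := ih
      refine ⟨q + ∑ i ∈ Finset.range m, S^[i] e, ?_⟩
      push_cast
      rw [add_smul, hq, one_smul, Finset.sum_range_succ _ m, map_add]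
      have hg := hgeo m
      rw [← sub_eq_iff_eq_add] at hg
      have hg2 : e = (e - S^[m] e) + S^[m] e := by abel
      have hg3 : ∀ P : X, q - S q + P + e = q - S q + P + ((e - S^[m] e) + S^[m] e) := by
        intro P
        rw [← hg2]
      rw [hg3, hg]
      abel
  have hnsum : ∀ m : ℕ, ‖∑ j ∈ Finset.range m, S^[j] e‖ ^ 2 = m := by
    intro m
    induction m with
    | zero => simp
    | succ m ih =>
      rw [Finset.sum_range_succ', norm_add_sq_real]
      have h1 : ∑ k ∈ Finset.range m, S^[k + 1] e = S (∑ k ∈ Finset.range m, S^[k] e) := by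
        rw [map_sum]
        exact Finset.sum_congr rfl fun k _ => Function.iterate_succ_apply' _ _ _
      rw [h1, hn, ih, Function.iterate_zero_apply, real_inner_comm, heS, he]
      push_cast
      ring
  obtain ⟨m, hm⟩ := exists_nat_gt (1 / ε ^ 2)
  have hm0 : (0 : ℝ) < m := lt_trans (by positivity) hm
  obtain ⟨q, hq⟩ := hsum m
  refine ⟨(1 / (m : ℝ)) • q, (1 / (m : ℝ)) • ∑ j ∈ Finset.range m, S^[j] e, ?_, ?_⟩
  · rw [map_smul, ← smul_sub, ← smul_add, ← hq, smul_smul, one_div_mul_cancel hm0.ne', one_smul]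
  · rw [norm_smul, Real.norm_eq_abs, abs_of_pos (by positivity)]
    refine abs_le_of_sq_le_sq' ?_ hε.le |>.2
    rw [mul_pow, hnsum]
    have h2 : 1 < m * ε ^ 2 := by
      rw [div_lt_iff₀ (by positivity)] at hm
      exact hm
    have h3 : (1 / (m : ℝ)) ^ 2 * m = 1 / m := by field_simp
    rw [h3, div_le_iff₀ hm0]
    linarith

theorem orbit_exists {X : Type*} [NormedAddCommGroup X] [InnerProductSpace ℝ X] [CompleteSpace X]
    (hX : ¬ FiniteDimensional ℝ X) (δ : ℕ → ℝ) (hδ0 : δ 0 = 1) (hpos : ∀ k, 0 < δ k)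
    (hle : ∀ k, δ k ≤ 1) :
    ∃ x z : ℕ → X,
      (∀ k, x k = x (k + 1) + δ k • z k) ∧
      (∀ k l, ⟪z k, x (l + 1)⟫ + ⟪x (k + 1), z l⟫ = 0) ∧
      (∀ l, ⟪x 0, x l⟫ = (1 + δ l) * ⟪x 0, x (l + 1)⟫) ∧
      ‖x 0‖ = 1 ∧ ‖x 1‖ ^ 2 = 1 / 2 ∧ (∀ k, ‖z k‖ ≤ 1) ∧
      ∀ ε : ℝ, 0 < ε → ∃ K : ℝ, 0 ≤ K ∧ ∀ n' n : ℕ, ∀ d : ℝ, 0 < d → n' ≤ n →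
        (∀ k, n' ≤ k → k < n → δ k = d) →
        ‖∑ k ∈ Finset.Ico n' n, x (k + 1)‖ ≤ K / d + ε * n := by
  obtain ⟨S, e, hS, he, heS⟩ := exists_shift hX
  have hn : ∀ a, ‖S a‖ = ‖a‖ := by
    intro a
    have := hS a a
    rw [real_inner_self_eq_norm_sq, real_inner_self_eq_norm_sq] at this
    exact (pow_left_inj₀ (norm_nonneg _) (norm_nonneg _) two_ne_zero).1 this
  choose E hE hES using fun k => exists_E S hS (δ k) (hpos k) (hle k)
  let J : ℕ → X → X := fun k x => (1 / 2 : ℝ) • (E k x + S (E k x))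
  let Q : ℕ → X → X := fun k x => (1 / 2 : ℝ) • (E k x - S (E k x))
  have hJQ : ∀ k x, x = J k x + δ k • Q k x := by
    intro k x
    have h := hE k x
    have h3 : J k x + δ k • Q k x
        = (1 / 2 : ℝ) • ((1 + δ k) • E k x + (1 - δ k) • S (E k x)) := by
      simp only [J, Q]
      module
    rw [h3, h, smul_smul]
    norm_num
  have hskew : ∀ k l x y, ⟪Q k x, J l y⟫ + ⟪J k x, Q l y⟫ = 0 := by
    intro k l x y
    simp only [J, Q, inner_smul_left, inner_smul_right, inner_add_left, inner_add_right,
      inner_sub_left, inner_sub_right, hS]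
    ring
  have hnorm : ∀ k x, ‖x‖ ^ 2 = ‖J k x‖ ^ 2 + δ k ^ 2 * ‖Q k x‖ ^ 2 := by
    intro k x
    have h1 := hskew k k x x
    rw [real_inner_comm] at h1
    have h2 : ⟪J k x, Q k x⟫ = 0 := by linarith
    nth_rewrite 1 [hJQ k x]
    rw [norm_add_sq_real, inner_smul_right, h2, norm_smul (δ k), mul_pow, Real.norm_eq_abs, sq_abs]
    ring
  have hJle : ∀ k x, ‖J k x‖ ≤ ‖x‖ := by
    intro k x
    refine abs_le_of_sq_le_sq' ?_ (norm_nonneg _) |>.2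
    have := hnorm k x
    have := mul_nonneg (sq_nonneg (δ k)) (sq_nonneg ‖Q k x‖)
    linarith
  have hJadd : ∀ k x y, J k (x + y) = J k x + J k y := by
    intro k x y
    simp only [J, map_add]
    module
  have hJsub : ∀ k x y, J k (x - y) = J k x - J k y := by
    intro k x y
    simp only [J, map_sub]
    module
  have hJS : ∀ k x, J k (S x) = S (J k x) := by
    intro k x
    simp only [J, map_smul, map_add, hES]
  have hJQc : ∀ k l x, Q l (J k x) = J l (Q k x) := by
    intro k l x
    simp only [J, Q, map_smul, map_add, map_sub, hES]
    module
  have horble : ∀ a k, ‖orbSeq J a k‖ ≤ ‖a‖ := by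
    intro a k
    induction k with
    | zero => exact le_rfl
    | succ k ih => exact (hJle _ _).trans ih
  have hlin : ∀ q r k, orbSeq J (q - S q + r) k
      = orbSeq J q k - S (orbSeq J q k) + orbSeq J r k := by
    intro q r k
    induction k with
    | zero => rfl
    | succ k ih =>
      simp only [orbSeq]
      rw [ih, hJadd, hJsub, hJS]
  have hE0 : E 0 e = e := by
    have := hE 0 e
    rw [hδ0] at this
    have h2 : (2 : ℝ) • E 0 e = (2 : ℝ) • e := by
      rw [← this]; module
    exact smul_right_injective X (two_ne_zero (α := ℝ)) h2
  have hJ0 : ‖J 0 e‖ ^ 2 = 1 / 2 := by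
    simp only [J]
    rw [hE0, norm_smul, mul_pow, norm_add_sq_real, hn, heS, he]
    norm_num
  refine ⟨orbSeq J e, fun k => Q k (orbSeq J e k), fun k => hJQ k _, fun k l => hskew k l _ _,
    ?_, he, hJ0, ?_, ?_⟩
  · intro l
    set y := orbSeq J e l with hy
    have h1 : orbSeq J e (l + 1) = J l y := rfl
    rw [h1]
    have h2 : ⟪e, (2 : ℝ) • y⟫ = (1 + δ l) * ⟪e, E l y⟫ := by
      rw [← hE l y, inner_add_right, inner_smul_right, inner_smul_right, heS]
      ring
    rw [inner_smul_right] at h2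
    have h3 : ⟪e, J l y⟫ = 1 / 2 * ⟪e, E l y⟫ := by
      simp only [J]
      rw [inner_smul_right, inner_add_right, heS]
      ring
    change ⟪e, y⟫ = (1 + δ l) * ⟪e, J l y⟫
    rw [h3]
    linarith
  · intro k
    induction k with
    | zero =>
      have h := hnorm 0 e
      rw [hδ0, he] at h
      change ‖Q 0 e‖ ≤ 1
      refine abs_le_of_sq_le_sq' ?_ zero_le_one |>.2
      nlinarith [sq_nonneg ‖J 0 e‖]
    | succ k ih =>
      change ‖Q (k + 1) (J k (orbSeq J e k))‖ ≤ 1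
      rw [hJQc]
      exact (hJle _ _).trans ih
  · intro ε hε
    obtain ⟨q, r, heq, hr⟩ := approx_range S hS e he heS ε hε
    refine ⟨4 * ‖q‖, by positivity, fun n' n d hd hnn hconst => ?_⟩
    have hstep : ∀ k, n' ≤ k → k < n → orbSeq J q (k + 1) - S (orbSeq J q (k + 1))
        = (1 / d) • ((orbSeq J q k + S (orbSeq J q k))
          - (orbSeq J q (k + 1) + S (orbSeq J q (k + 1)))) := by
      intro k h1 h2
      set y := orbSeq J q k
      have h3 : orbSeq J q (k + 1) = J k y := rfl
      rw [h3]
      have h4 : y = J k y + d • Q k y := by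
        have := hJQ k y
        rwa [hconst k h1 h2] at this
      have h5 : y - J k y = d • Q k y := by
        nth_rewrite 1 [h4]
        abel
      have h6 : (y + S y) - (J k y + S (J k y)) = d • (Q k y + S (Q k y)) := by
        rw [smul_add, ← map_smul S d, ← h5, map_sub]
        abel
      rw [h6, smul_smul, one_div_mul_cancel hd.ne', one_smul]
      simp only [J, Q, map_smul, map_add, map_sub]
      module
    have htel : ∑ k ∈ Finset.Ico n' n, (orbSeq J q (k + 1) - S (orbSeq J q (k + 1)))
        = (1 / d) • ((orbSeq J q n' + S (orbSeq J q n'))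
          - (orbSeq J q n + S (orbSeq J q n))) := by
      rw [Finset.sum_congr rfl (fun k hk => hstep k (Finset.mem_Ico.1 hk).1 (Finset.mem_Ico.1 hk).2),
        ← Finset.smul_sum]
      congr 1
      have := Finset.sum_Ico_sub (fun k => orbSeq J q k + S (orbSeq J q k)) hnn
      rw [← neg_inj, ← Finset.sum_neg_distrib, neg_sub, ← this]
      exact Finset.sum_congr rfl fun k _ => by rw [neg_sub]
    have hsplit : ∑ k ∈ Finset.Ico n' n, orbSeq J e (k + 1)
        = ∑ k ∈ Finset.Ico n' n, (orbSeq J q (k + 1) - S (orbSeq J q (k + 1)))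
          + ∑ k ∈ Finset.Ico n' n, orbSeq J r (k + 1) := by
      rw [← Finset.sum_add_distrib]
      refine Finset.sum_congr rfl fun k _ => ?_
      rw [heq]
      exact hlin q r (k + 1)
    have hb : ∀ k, ‖orbSeq J q k + S (orbSeq J q k)‖ ≤ 2 * ‖q‖ := by
      intro k
      have h1 := norm_add_le (orbSeq J q k) (S (orbSeq J q k))
      rw [hn] at h1
      have h2 := horble q k
      linarith
    rw [hsplit, htel]
    refine (norm_add_le _ _).trans (add_le_add ?_ ?_)
    · rw [norm_smul, Real.norm_eq_abs, abs_of_pos (by positivity)]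
      have h1 := norm_sub_le (orbSeq J q n' + S (orbSeq J q n')) (orbSeq J q n + S (orbSeq J q n))
      have h2 := hb n'
      have h3 := hb n
      rw [one_div, inv_mul_eq_div]
      gcongr
      linarith
    · refine (norm_sum_le _ _).trans ?_
      have h1 : ∀ k ∈ Finset.Ico n' n, ‖orbSeq J r (k + 1)‖ ≤ ε :=
        fun k _ => (horble r _).trans hr
      refine (Finset.sum_le_card_nsmul _ _ _ h1).trans ?_
      rw [nsmul_eq_mul, Nat.card_Ico, mul_comm]
      gcongr
      exact Nat.sub_le _ _

theorem gram_nonneg (G : ℕ → ℕ → ℝ) (δ : ℕ → ℝ) (hpos : ∀ k, 0 < δ k)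
    (hsym : ∀ k l, G k l = G l k)
    (hR : ∀ k l, δ l * (G k (l + 1) - G (k + 1) (l + 1))
      + δ k * (G (k + 1) l - G (k + 1) (l + 1)) = 0)
    (h0 : ∀ l, 0 ≤ G 0 l) : ∀ k l, 0 ≤ G k l := by
  intro k
  induction k with
  | zero => exact h0
  | succ k ihk =>
    intro l
    induction l with
    | zero => rw [hsym]; exact h0 _
    | succ l ihl =>
      have h1 := hR k l
      have h2 : (δ l + δ k) * G (k + 1) (l + 1) = δ l * G k (l + 1) + δ k * G (k + 1) l := by
        linarith
      have h3 : 0 ≤ (δ l + δ k) * G (k + 1) (l + 1) := by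
        rw [h2]
        exact add_nonneg (mul_nonneg (hpos l).le (ihk _)) (mul_nonneg (hpos k).le ihl)
      exact nonneg_of_mul_nonneg_right h3 (add_pos (hpos l) (hpos k))

theorem gram_anti (G : ℕ → ℕ → ℝ) (δ : ℕ → ℝ) (hpos : ∀ k, 0 < δ k)
    (hsym : ∀ k l, G k l = G l k)
    (hR : ∀ k l, δ l * (G k (l + 1) - G (k + 1) (l + 1))
      + δ k * (G (k + 1) l - G (k + 1) (l + 1)) = 0)
    (h0 : ∀ l, G 0 (l + 1) ≤ G 0 l) : ∀ k l, k ≤ l → G k (l + 1) ≤ G k l := by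
  intro k
  induction k with
  | zero => exact fun l _ => h0 l
  | succ k ihk =>
    intro l hl
    -- it suffices to know `G k l ≤ G (k+1) l`
    have main : ∀ l, k + 1 ≤ l → G k l ≤ G (k + 1) l → G (k + 1) (l + 1) ≤ G (k + 1) l := by
      intro l hl h
      have h1 := ihk l (by omega)
      have h2 := hR k l
      have h3 : δ l * (G k (l + 1) - G (k + 1) l)
        = (δ l + δ k) * (G (k + 1) (l + 1) - G (k + 1) l) := by linarith
      have h4 : δ l * (G k (l + 1) - G (k + 1) l) ≤ 0 :=
        mul_nonpos_of_nonneg_of_nonpos (hpos l).le (by linarith)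
      rw [h3] at h4
      have := nonpos_of_mul_nonpos_right h4 (add_pos (hpos l) (hpos k))
      linarith
    induction l, hl using Nat.le_induction with
    | base =>
      apply main _ le_rfl
      have h1 := hR k k
      rw [hsym (k + 1) k] at h1
      have h2 : δ k * (G k (k + 1) - G (k + 1) (k + 1)) = 0 := by linarith
      have := (mul_eq_zero.1 h2).resolve_left (hpos k).ne'
      linarith
    | succ l hl ih =>
      apply main _ (by omega)
      have h1 := hR k l
      have h2 : 0 ≤ δ k * (G (k + 1) l - G (k + 1) (l + 1)) :=
        mul_nonneg (hpos k).le (by linarith)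
      have h3 : δ l * (G k (l + 1) - G (k + 1) (l + 1)) ≤ 0 := by linarith
      have := nonpos_of_mul_nonpos_right h3 (hpos l)
      linarith

theorem decay_aux (a b δ : ℕ → ℝ) (c : ℝ) (hc : 0 < c) (m : ℕ) (hpos : ∀ k, 0 < δ k)
    (hdiv : ∀ C : ℝ, ∃ n, C ≤ ∑ k ∈ Finset.range n, δ k)
    (ha : ∀ l, 0 ≤ a l) (hanti : ∀ l, m ≤ l → a (l + 1) ≤ a l)
    (hb : Tendsto b atTop (nhds 0))
    (hrel : ∀ l, δ l * (a (l + 1) - b (l + 1)) = c * (a l - a (l + 1))) :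
    Tendsto a atTop (nhds 0) := by
  rw [Metric.tendsto_atTop]
  by_contra hcon
  push Not at hcon
  obtain ⟨ε, hε, hN⟩ := hcon
  have hge : ∀ l, m ≤ l → ε ≤ a l := by
    intro l hl
    obtain ⟨n, hn, h⟩ := hN l
    rw [Real.dist_eq, sub_zero, abs_of_nonneg (ha n)] at h
    have : a n ≤ a l := by
      clear h
      induction n, hn using Nat.le_induction with
      | base => exact le_rfl
      | succ n hn ih => exact (hanti n (by omega)).trans ih
    linarith
  obtain ⟨N, hN'⟩ := Metric.tendsto_atTop.1 hb (ε / 2) (by linarith)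
  let M := max N m
  have hstep : ∀ l, M ≤ l → δ l * (ε / 2) ≤ c * (a l - a (l + 1)) := by
    intro l hl
    rw [← hrel]
    have h1 := hge (l + 1) (le_trans (le_max_right N m) (by omega))
    have h2 := hN' (l + 1) (le_trans (le_max_left N m) (by omega))
    rw [Real.dist_eq, sub_zero] at h2
    have h3 := le_abs_self (b (l + 1))
    exact mul_le_mul_of_nonneg_left (by linarith) (hpos l).le
  have hsum : ∀ n, M ≤ n → (∑ k ∈ Finset.range n, δ k) * (ε / 2)
      ≤ (∑ k ∈ Finset.range M, δ k) * (ε / 2) + c * (a M - a n) := by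
    intro n hn
    induction n, hn using Nat.le_induction with
    | base => simp
    | succ n hn ih =>
      rw [Finset.sum_range_succ, add_mul]
      have := hstep n hn
      linarith
  obtain ⟨n, hn⟩ := hdiv (((∑ k ∈ Finset.range M, δ k) * (ε / 2) + c * a M + 1) / (ε / 2))
  have hn2 : ((∑ k ∈ Finset.range M, δ k) * (ε / 2) + c * a M + 1) / (ε / 2)
      ≤ ∑ k ∈ Finset.range (max n M), δ k :=
    hn.trans (Finset.sum_le_sum_of_subset_of_nonneg
      (Finset.range_subset_range.2 (le_max_left _ _)) fun k _ _ => (hpos k).le)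
  rw [div_le_iff₀ (by linarith)] at hn2
  have h3 := hsum _ (le_max_right n M)
  have h4 := mul_nonneg hc.le (ha (max n M))
  linarith

theorem speeds_exist : ∃ δ : ℕ → ℝ, δ 0 = 1 ∧ (∀ k, 0 < δ k) ∧ (∀ k, δ k ≤ 1) ∧ Antitone δ ∧
    (∀ n, ∑ k ∈ Finset.range n, δ (k + 1) ^ 2 ≤ 1 / 4) ∧
    (∀ N : ℕ, ∃ n' n : ℕ, N ≤ n ∧ 0 < n' ∧ 16 * n' ≤ n ∧ n * δ n' ≤ 1 / 16) ∧
    (∀ C : ℝ, ∃ n' n : ℕ, C * (n' + 1) ≤ n ∧ n' < n ∧ C ≤ n ∧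
      (∀ k, n' ≤ k → k < n → δ k = δ n') ∧ C ≤ δ n' * n) := by
  let I : ℕ → ℕ := fun k => Nat.log 2 (Nat.log 4 k)
  let D : ℕ → ℝ := fun k => ((2 : ℝ) ^ (2 ^ I k))⁻¹ ^ 3
  have hI : ∀ i k, 4 ^ 2 ^ i ≤ k → k < 4 ^ 2 ^ (i + 1) → I k = i := by
    intro i k h1 h2
    have hk : k ≠ 0 := by
      have : 0 < 4 ^ 2 ^ i := by positivity
      omega
    have h3 := Nat.le_log_of_pow_le (by norm_num) h1
    have h4 := Nat.log_lt_of_lt_pow hk h2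
    exact Nat.log_eq_of_pow_le_of_lt_pow h3 h4
  have hIm : Monotone I := fun a b hab => Nat.log_mono_right (Nat.log_mono_right hab)
  have hDpos : ∀ k, 0 < D k := fun k => by positivity
  have hDle : ∀ k, D k ≤ 1 := fun k =>
    pow_le_one₀ (by positivity) (inv_le_one_of_one_le₀ (one_le_pow₀ (by norm_num)))
  have hDanti : Antitone D := by
    intro a b hab
    have := hIm hab
    simp only [D]
    gcongr <;> norm_num
  have hIlt : ∀ k, k < 4 ^ 2 ^ (I k + 1) := by
    intro k
    have h1 : Nat.log 4 k < 2 ^ (I k + 1) := Nat.lt_pow_succ_log_self (by norm_num) _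
    calc k < 4 ^ (Nat.log 4 k + 1) := Nat.lt_pow_succ_log_self (by norm_num) _
      _ ≤ _ := Nat.pow_le_pow_right (by norm_num) h1
  have hDsq : ∀ k : ℕ, D (k + 1) ^ 2 ≤ 1 / ((k + 1 : ℕ) : ℝ) ^ (3 / 2 : ℝ) := by
    intro k
    refine (pow_le_pow_iff_left₀ (by positivity) (by positivity) (two_ne_zero)).1 ?_
    have h1 : ((1 : ℝ) / ((k + 1 : ℕ) : ℝ) ^ (3 / 2 : ℝ)) ^ 2 = 1 / ((k + 1 : ℕ) : ℝ) ^ 3 := by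
      rw [div_pow, one_pow, ← Real.rpow_natCast (((k + 1 : ℕ) : ℝ) ^ (3 / 2 : ℝ)) 2,
        ← Real.rpow_mul (by positivity), ← Real.rpow_natCast _ 3]
      norm_num
    rw [h1]
    have h2 : (((k + 1 : ℕ) : ℝ)) ≤ ((2 : ℝ) ^ 2 ^ I (k + 1)) ^ 4 := by
      have := (hIlt (k + 1)).le
      have h3 : (4 : ℕ) ^ 2 ^ (I (k + 1) + 1) = (2 ^ 2 ^ I (k + 1)) ^ 4 := by
        rw [show (4 : ℕ) = 2 ^ 2 from rfl, ← pow_mul, ← pow_mul, pow_succ]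
        ring_nf
      rw [h3] at this
      exact_mod_cast this
    set s := (2 : ℝ) ^ 2 ^ I (k + 1) with hs
    have hs0 : 0 < s := by positivity
    have : (D (k + 1) ^ 2) ^ 2 = 1 / (s ^ 4) ^ 3 := by
      simp only [D, ← hs]
      field_simp
    rw [this]
    gcongr
  have hsumm : Summable (fun k : ℕ => D (k + 1) ^ 2) := by
    have h1 : Summable (fun k : ℕ => 1 / (k : ℝ) ^ (3 / 2 : ℝ)) :=
      Real.summable_one_div_nat_rpow.2 (by norm_num)
    exact Summable.of_nonneg_of_le (fun k => by positivity) hDsq ((summable_nat_add_iff 1).2 h1)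
  set Tot := ∑' k : ℕ, D (k + 1) ^ 2 with hTot
  have hTot0 : 0 ≤ Tot := tsum_nonneg fun k => by positivity
  obtain ⟨η, hη0, hη1, hη2⟩ : ∃ η : ℝ, 0 < η ∧ η ≤ 1 ∧ η ^ 2 * Tot ≤ 1 / 4 := by
    refine ⟨1 / (4 * (Tot + 1)), by positivity, ?_, ?_⟩
    · rw [div_le_one (by positivity)]; linarith
    · rw [div_pow, one_pow, div_mul_eq_mul_div, div_le_iff₀ (by positivity)]
      nlinarith
  let δ : ℕ → ℝ := fun k => if k = 0 then 1 else η * D k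
  have hδ : ∀ k, 0 < k → δ k = η * D k := fun k hk => if_neg hk.ne'
  have hηD : ∀ k, η * D k ≤ 1 := fun k => mul_le_one₀ hη1 (hDpos k).le (hDle k)
  -- growth
  have hDt : ∀ i, D (4 ^ 2 ^ i) = ((2 : ℝ) ^ 2 ^ i)⁻¹ ^ 3 := by
    intro i
    simp only [D]
    rw [hI i _ le_rfl (Nat.pow_lt_pow_right (by norm_num) (Nat.pow_lt_pow_right (by norm_num) (by omega)))]
  have ht : ∀ i, ((4 ^ 2 ^ i : ℕ) : ℝ) = ((2 : ℝ) ^ 2 ^ i) ^ 2 := by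
    intro i
    push_cast
    rw [show (4 : ℝ) = 2 ^ 2 by norm_num, ← pow_mul, ← pow_mul, mul_comm]
  have hgrow : ∀ C : ℝ, ∃ i, C ≤ (2 : ℝ) ^ 2 ^ i := by
    intro C
    obtain ⟨i, hi⟩ := exists_nat_ge C
    refine ⟨i, hi.trans ?_⟩
    have h1 : i < 2 ^ i := Nat.lt_two_pow_self
    have h2 : 2 ^ i < 2 ^ 2 ^ i := Nat.lt_two_pow_self
    exact_mod_cast (h1.trans h2).le
  refine ⟨δ, if_pos rfl, ?_, ?_, ?_, ?_, ?_, ?_⟩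
  · intro k
    rcases Nat.eq_zero_or_pos k with rfl | hk
    · simp [δ]
    · rw [hδ k hk]; exact mul_pos hη0 (hDpos k)
  · intro k
    rcases Nat.eq_zero_or_pos k with rfl | hk
    · simp [δ]
    · rw [hδ k hk]; exact hηD k
  · intro a b hab
    rcases Nat.eq_zero_or_pos b with rfl | hb
    · rw [Nat.le_zero.1 hab]
    rcases Nat.eq_zero_or_pos a with rfl | ha
    · rw [hδ b hb]; simpa [δ] using hηD b
    · rw [hδ b hb, hδ a ha]
      exact mul_le_mul_of_nonneg_left (hDanti hab) hη0.le
  · intro n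
    have h1 : ∀ k, δ (k + 1) ^ 2 = η ^ 2 * D (k + 1) ^ 2 := by
      intro k
      rw [hδ _ k.succ_pos, mul_pow]
    simp only [h1]
    rw [← Finset.mul_sum]
    refine le_trans ?_ hη2
    gcongr
    exact hsumm.sum_le_tsum _ fun k _ => by positivity
  · intro N
    obtain ⟨i, hi⟩ := hgrow (max N 256)
    have hi1 : (N : ℝ) ≤ (2 : ℝ) ^ 2 ^ i := (le_max_left _ _).trans hi
    have hi2 : (256 : ℝ) ≤ (2 : ℝ) ^ 2 ^ i := (le_max_right _ _).trans hi
    refine ⟨4 ^ 2 ^ i, 16 * 4 ^ 2 ^ i, ?_, by positivity, le_rfl, ?_⟩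
    · have h2 : (N : ℝ) ≤ ((16 * 4 ^ 2 ^ i : ℕ) : ℝ) := by
        rw [Nat.cast_mul, ht]
        push_cast
        nlinarith
      exact_mod_cast h2
    · rw [hδ _ (by positivity), Nat.cast_mul, ht, hDt]
      set s := (2 : ℝ) ^ 2 ^ i
      have hs0 : 0 < s := by linarith
      have : ((16 : ℕ) : ℝ) * s ^ 2 * (η * s⁻¹ ^ 3) = η * (16 / s) := by
        push_cast
        field_simp
      rw [this]
      have h3 : 16 / s ≤ 1 / 16 := by
        rw [div_le_div_iff₀ hs0 (by norm_num)]; linarith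
      calc η * (16 / s) ≤ 1 * (16 / s) := by gcongr
        _ ≤ 1 / 16 := by linarith
  · intro C
    obtain ⟨i, hi⟩ := hgrow (max (2 * |C| + 2) (|C| / η))
    have hi1 : 2 * |C| + 2 ≤ (2 : ℝ) ^ 2 ^ i := (le_max_left _ _).trans hi
    have hi2 : |C| / η ≤ (2 : ℝ) ^ 2 ^ i := (le_max_right _ _).trans hi
    have hC := le_abs_self C
    have hC0 := abs_nonneg C
    have hlt : 4 ^ 2 ^ i < 4 ^ 2 ^ (i + 1) :=
      Nat.pow_lt_pow_right (by norm_num) (Nat.pow_lt_pow_right (by norm_num) (by omega))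
    have hsq : (2 : ℝ) ^ 2 ^ (i + 1) = ((2 : ℝ) ^ 2 ^ i) ^ 2 := by
      rw [← pow_mul, pow_succ]
    have hp : 0 < 4 ^ 2 ^ i := by positivity
    refine ⟨4 ^ 2 ^ i, 4 ^ 2 ^ (i + 1), ?_, hlt, ?_, ?_, ?_⟩
    · rw [ht, ht, hsq]
      set s := (2 : ℝ) ^ 2 ^ i
      calc C * (s ^ 2 + 1) ≤ |C| * (s ^ 2 + s ^ 2) := by
            gcongr
            nlinarith
        _ = 2 * |C| * s ^ 2 := by ring
        _ ≤ s ^ 2 * s ^ 2 := by gcongr; nlinarith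
        _ = _ := by ring
    · rw [ht, hsq]
      set s := (2 : ℝ) ^ 2 ^ i
      have h1 : 1 ≤ s := by linarith
      calc C ≤ s ^ 1 := by linarith
        _ ≤ s ^ 4 := pow_le_pow_right₀ h1 (by norm_num)
        _ = _ := by ring
    · intro k h1 h2
      rw [hδ _ (by omega), hδ _ (by omega)]
      simp only [D]
      rw [hI i k h1 h2, hI i _ le_rfl hlt]
    · rw [hδ _ hp, ht, hsq, hDt]
      set s := (2 : ℝ) ^ 2 ^ i
      have hs0 : 0 < s := by linarith
      have : η * s⁻¹ ^ 3 * (s ^ 2) ^ 2 = η * s := by field_simp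
      rw [this]
      rw [div_le_iff₀ hη0] at hi2
      linarith

theorem weak_null {X : Type*} [NormedAddCommGroup X] [InnerProductSpace ℝ X] [CompleteSpace X]
    (x : ℕ → X) (hb : ∀ k, ‖x k‖ ≤ 1)
    (hG : ∀ k, Tendsto (fun l => ⟪x k, x l⟫) atTop (nhds 0)) (z : X) :
    Tendsto (fun l => ⟪x l, z⟫) atTop (nhds 0) := by
  let M : Submodule ℝ X :=
    { carrier := {z | Tendsto (fun l => ⟪x l, z⟫) atTop (nhds 0)}
      add_mem' := by
        intro a b ha hb
        have := Tendsto.add ha hb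
        simpa [inner_add_right] using this
      zero_mem' := by simp
      smul_mem' := by
        intro c a ha
        have := Tendsto.const_mul c ha
        simpa [inner_smul_right] using this }
  have hcl : IsClosed (M : Set X) := by
    rw [← closure_subset_iff_isClosed]
    intro a ha
    change Tendsto (fun l => ⟪x l, a⟫) atTop (nhds 0)
    rw [Metric.tendsto_atTop]
    intro ε hε
    obtain ⟨b, hbM, hab⟩ := Metric.mem_closure_iff.1 ha (ε / 2) (by linarith)
    obtain ⟨N, hN⟩ := Metric.tendsto_atTop.1 (show Tendsto (fun l => ⟪x l, b⟫) atTop (nhds 0)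
      from hbM) (ε / 2) (by linarith)
    refine ⟨N, fun n hn => ?_⟩
    have h1 := hN n hn
    rw [Real.dist_eq, sub_zero] at h1 ⊢
    have h2 : ⟪x n, a⟫ = ⟪x n, a - b⟫ + ⟪x n, b⟫ := by rw [inner_sub_right]; ring
    have h3 : |⟪x n, a - b⟫| ≤ ‖x n‖ * ‖a - b‖ := abs_real_inner_le_norm _ _
    rw [dist_eq_norm] at hab
    have h4 : ‖x n‖ * ‖a - b‖ ≤ 1 * ‖a - b‖ := mul_le_mul_of_nonneg_right (hb n) (norm_nonneg _)
    rw [h2]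
    have := abs_add_le ⟪x n, a - b⟫ ⟪x n, b⟫
    linarith
  have hxM : ∀ k, x k ∈ M := by
    intro k
    change Tendsto (fun l => ⟪x l, x k⟫) atTop (nhds 0)
    simpa only [real_inner_comm] using hG k
  have : CompleteSpace M := hcl.completeSpace_coe
  obtain ⟨a, ha, b, hb', rfl⟩ := M.exists_add_mem_mem_orthogonal z
  have hbM : b ∈ M := by
    change Tendsto (fun l => ⟪x l, b⟫) atTop (nhds 0)
    have : (fun l => ⟪x l, b⟫) = fun _ => 0 := by
      funext l
      exact hb' _ (hxM l)
    rw [this]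
    exact tendsto_const_nhds
  exact M.add_mem ha hbM

theorem exists_bizarre_cesaro_means
    {X : Type*} [NormedAddCommGroup X] [InnerProductSpace ℝ X] [CompleteSpace X]
    (hX : ¬ FiniteDimensional ℝ X) :
    ∃ (T : X → X) (x₁ : X),
      (∀ a b : X, ‖T a - T b‖ ^ 2 ≤ ⟪a - b, T a - T b⟫) ∧
      {a : X | T a = a} = {0} ∧
      (∀ z : X,
        Tendsto
          (fun n : ℕ => ⟪(1 / (n : ℝ)) • ∑ k ∈ Finset.Icc 1 n, T^[k - 1] x₁, z⟫)
          atTop (nhds 0)) ∧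
      Filter.liminf
        (fun n : ℕ => ‖(1 / (n : ℝ)) • ∑ k ∈ Finset.Icc 1 n, T^[k - 1] x₁‖)
        atTop = 0 ∧
      0 < Filter.limsup
        (fun n : ℕ => ‖(1 / (n : ℝ)) • ∑ k ∈ Finset.Icc 1 n, T^[k - 1] x₁‖)
        atTop := by
  obtain ⟨δ, hδ0, hpos, hle, hanti, hsq, hP1, hP2⟩ := speeds_exist
  obtain ⟨x, z, hxz, hskew, hx0l, hx0, hx1, hz, hmean⟩ := orbit_exists hX δ hδ0 hpos hle
  -- divergence of the speeds
  have hdiv : ∀ C : ℝ, ∃ n, C ≤ ∑ k ∈ Finset.range n, δ k := by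
    intro C
    obtain ⟨n', n, -, hlt, -, hc, hC⟩ := hP2 C
    refine ⟨n, hC.trans ?_⟩
    have : ∀ k ∈ Finset.range n, δ n' ≤ δ k := by
      intro k hk
      rw [Finset.mem_range] at hk
      rcases le_total n' k with h | h
      · exact (hc k h hk).ge
      · exact hanti h
    have := Finset.card_nsmul_le_sum _ _ _ this
    rw [nsmul_eq_mul, Finset.card_range] at this
    linarith
  -- Gram matrix
  have hdz : ∀ k, δ k • z k = x k - x (k + 1) := by
    intro k
    rw [eq_sub_iff_add_eq, add_comm]
    exact (hxz k).symm
  let G : ℕ → ℕ → ℝ := fun k l => ⟪x k, x l⟫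
  have hsym : ∀ k l, G k l = G l k := fun k l => real_inner_comm _ _
  have hR : ∀ k l, δ l * (G k (l + 1) - G (k + 1) (l + 1))
      + δ k * (G (k + 1) l - G (k + 1) (l + 1)) = 0 := by
    intro k l
    simp only [G]
    rw [← inner_sub_left, ← inner_sub_right, ← hdz, ← hdz, inner_smul_left, inner_smul_right]
    have := hskew k l
    simp only [RCLike.conj_to_real]
    linear_combination (δ k * δ l) * this
  have hG0 : ∀ l, 0 ≤ G 0 l := by
    intro l
    induction l with
    | zero => exact real_inner_self_nonneg
    | succ l ih =>
      have h1 : G 0 l = (1 + δ l) * G 0 (l + 1) := hx0l l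
      rw [h1] at ih
      exact nonneg_of_mul_nonneg_right ih (by linarith [hpos l])
  have hGn := gram_nonneg G δ hpos hsym hR hG0
  have hGa : ∀ k l, k ≤ l → G k (l + 1) ≤ G k l := by
    refine gram_anti G δ hpos hsym hR fun l => ?_
    have h1 : G 0 l = (1 + δ l) * G 0 (l + 1) := hx0l l
    have := mul_nonneg (hpos l).le (hG0 (l + 1))
    linarith
  have hGlim : ∀ k, Tendsto (fun l => G k l) atTop (nhds 0) := by
    intro k
    induction k with
    | zero =>
      refine decay_aux (G 0) (fun _ => 0) δ 1 one_pos 0 hpos hdiv hG0 (fun l h => hGa 0 l h)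
        tendsto_const_nhds fun l => ?_
      have h1 : G 0 l = (1 + δ l) * G 0 (l + 1) := hx0l l
      rw [h1]
      ring
    | succ k ih =>
      refine decay_aux (G (k + 1)) (G k) δ (δ k) (hpos k) (k + 1) hpos hdiv (hGn _)
        (fun l h => hGa _ l h) ih fun l => ?_
      linarith [hR k l]
  -- norms
  have horth : ∀ k, ⟪x (k + 1), z k⟫ = 0 := by
    intro k
    have := hskew k k
    rw [real_inner_comm] at this
    linarith
  have hnorm : ∀ k, ‖x k‖ ^ 2 = ‖x (k + 1)‖ ^ 2 + δ k ^ 2 * ‖z k‖ ^ 2 := by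
    intro k
    rw [hxz k, norm_add_sq_real, inner_smul_right, horth, norm_smul, mul_pow, Real.norm_eq_abs,
      sq_abs]
    ring
  have hxle : ∀ k, ‖x k‖ ≤ 1 := by
    intro k
    induction k with
    | zero => exact hx0.le
    | succ k ih =>
      refine le_trans (abs_le_of_sq_le_sq' ?_ (norm_nonneg _)).2 ih
      have := mul_nonneg (sq_nonneg (δ k)) (sq_nonneg ‖z k‖)
      linarith [hnorm k]
  have hlow : ∀ k, 1 / 2 - ∑ j ∈ Finset.range k, δ (j + 1) ^ 2 ≤ ‖x (k + 1)‖ ^ 2 := by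
    intro k
    induction k with
    | zero => simp [hx1]
    | succ k ih =>
      rw [Finset.sum_range_succ]
      have h1 := hnorm (k + 1)
      have h2 : ‖z (k + 1)‖ ^ 2 ≤ 1 := pow_le_one₀ (norm_nonneg _) (hz _)
      have h3 := mul_le_mul_of_nonneg_left h2 (sq_nonneg (δ (k + 1)))
      linarith
  have hxge : ∀ k, 1 / 2 ≤ ‖x k‖ := by
    intro k
    cases k with
    | zero => rw [hx0]; norm_num
    | succ k =>
      refine (abs_le_of_sq_le_sq' ?_ (norm_nonneg _)).2
      have := hlow k
      have := hsq k
      linarith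
  have hweak : ∀ w, Tendsto (fun l => ⟪x l, w⟫) atTop (nhds 0) := weak_null x hxle hGlim
  -- the nonexpansive map
  obtain ⟨u, hu⟩ : ∃ u : ℕ → X, ∀ k, u k = (2 : ℝ) • x (k + 1) - x k := ⟨_, fun _ => rfl⟩
  have hGdiag : ∀ k, G k (k + 1) = G (k + 1) (k + 1) := by
    intro k
    have h1 := hR k k
    rw [hsym (k + 1) k] at h1
    have h2 : δ k * (G k (k + 1) - G (k + 1) (k + 1)) = 0 := by linarith
    have := (mul_eq_zero.1 h2).resolve_left (hpos k).ne'
    linarith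
  have huu : ∀ k l, ⟪u k, u l⟫ = 4 * G (k + 1) (l + 1) - 2 * G (k + 1) l - 2 * G k (l + 1)
      + G k l := by
    intro k l
    simp only [hu, G, inner_sub_left, inner_sub_right, inner_smul_left, inner_smul_right,
      RCLike.conj_to_real]
    ring
  have hun : ∀ k, ‖u k‖ ^ 2 = ‖x k‖ ^ 2 := by
    intro k
    rw [← real_inner_self_eq_norm_sq, ← real_inner_self_eq_norm_sq, huu, hsym (k + 1) k, hGdiag]
    simp only [G]
    ring
  have hcross : ∀ k l, k < l → G k l ≤ ⟪u k, u l⟫ := by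
    intro k l hkl
    rw [huu]
    have h1 := hR k l
    have h2 := hGa (k + 1) l hkl
    have h3 := hanti hkl.le
    have h4 : δ l * (G (k + 1) (l + 1) - G k (l + 1))
        = δ k * (G (k + 1) l - G (k + 1) (l + 1)) := by linarith
    have h5 : δ l * (G (k + 1) l - G (k + 1) (l + 1))
        ≤ δ k * (G (k + 1) l - G (k + 1) (l + 1)) :=
      mul_le_mul_of_nonneg_right h3 (by linarith)
    have h6 : G (k + 1) l - G (k + 1) (l + 1) ≤ G (k + 1) (l + 1) - G k (l + 1) := by
      rw [← h4] at h5
      exact le_of_mul_le_mul_left h5 (hpos l)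
    linarith
  have hcross' : ∀ k l, ‖u k - u l‖ ≤ ‖x k - x l‖ := by
    have aux : ∀ k l, k < l → ‖u k - u l‖ ≤ ‖x k - x l‖ := by
      intro k l hkl
      refine (abs_le_of_sq_le_sq' ?_ (norm_nonneg _)).2
      rw [norm_sub_sq_real (u k) (u l), norm_sub_sq_real (x k) (x l), hun, hun]
      have : ⟪x k, x l⟫ ≤ ⟪u k, u l⟫ := hcross k l hkl
      linarith
    intro k l
    rcases lt_trichotomy k l with h | rfl | h
    · exact aux k l h
    · simp
    · rw [norm_sub_rev, norm_sub_rev (x k)]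
      exact aux l k h
  let P : Set X := {w | ∀ k, ⟪x k, w⟫ ≤ 0}
  have hPx : ∀ w ∈ P, ∀ k, ‖u k‖ ≤ ‖x k - w‖ := by
    intro w hw k
    refine (abs_le_of_sq_le_sq' ?_ (norm_nonneg _)).2
    rw [hun, norm_sub_sq_real]
    have := hw k
    nlinarith [sq_nonneg ‖w‖]
  obtain ⟨N, hN, hNA⟩ := kirs_extension
    ((Set.range fun k => (x k, u k)) ∪ ((fun w => (w, (0 : X))) '' P)) (by
      rintro p (⟨k, rfl⟩ | ⟨w, hw, rfl⟩) q (⟨l, rfl⟩ | ⟨v, hv, rfl⟩)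
      · exact hcross' k l
      · simpa using hPx v hv k
      · simp only [zero_sub, norm_neg]
        rw [norm_sub_rev]
        exact hPx w hw l
      · simp)
  have hNx : ∀ k, N (x k) = u k := fun k => hNA (x k, u k) (Or.inl ⟨k, rfl⟩)
  have hNP : ∀ w ∈ P, N w = 0 := fun w hw => hNA (w, 0) (Or.inr ⟨w, hw, rfl⟩)
  let T : X → X := fun a => (1 / 2 : ℝ) • (a + N a)
  have hTx : ∀ k, T (x k) = x (k + 1) := by
    intro k
    simp only [T, hNx, hu]
    module
  have hiter : ∀ k, T^[k] (x 0) = x k := by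
    intro k
    induction k with
    | zero => rfl
    | succ k ih => rw [Function.iterate_succ_apply', ih, hTx]
  have hsum : ∀ n : ℕ, ∑ k ∈ Finset.Icc 1 n, T^[k - 1] (x 0) = ∑ k ∈ Finset.range n, x k := by
    intro n
    induction n with
    | zero => simp
    | succ n ih =>
      rw [Finset.sum_Icc_succ_top (by omega), ih, Finset.sum_range_succ, Nat.add_sub_cancel, hiter]
  have hyle : ∀ n : ℕ, ‖(1 / (n : ℝ)) • ∑ k ∈ Finset.range n, x k‖ ≤ 1 := by
    intro n
    rw [norm_smul, Real.norm_eq_abs, abs_of_nonneg (by positivity)]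
    have h1 : ‖∑ k ∈ Finset.range n, x k‖ ≤ n := by
      refine (norm_sum_le _ _).trans ?_
      have := Finset.sum_le_card_nsmul (Finset.range n) (fun k => ‖x k‖) 1 fun k _ => hxle k
      simpa using this
    rcases Nat.eq_zero_or_pos n with rfl | hn
    · simp
    · have hn' : (0 : ℝ) < n := by exact_mod_cast hn
      rw [one_div, inv_mul_eq_div, div_le_one hn']
      exact h1
  have hbdd : IsBoundedUnder (· ≤ ·) atTop
      (fun n : ℕ => ‖(1 / (n : ℝ)) • ∑ k ∈ Finset.range n, x k‖) :=
    isBoundedUnder_of ⟨1, hyle⟩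
  have hbdd' : IsBoundedUnder (· ≥ ·) atTop
      (fun n : ℕ => ‖(1 / (n : ℝ)) • ∑ k ∈ Finset.range n, x k‖) :=
    isBoundedUnder_of ⟨0, fun n => norm_nonneg _⟩
  refine ⟨T, x 0, ?_, ?_, ?_, ?_, ?_⟩
  · intro a b
    have h1 := hN a b
    have h2 : T a - T b = (1 / 2 : ℝ) • ((a - b) + (N a - N b)) := by
      simp only [T]
      module
    have h3 : ‖N a - N b‖ ^ 2 ≤ ‖a - b‖ ^ 2 := by gcongr
    rw [h2, norm_smul, mul_pow, norm_add_sq_real, inner_smul_right, inner_add_right,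
      real_inner_self_eq_norm_sq, Real.norm_eq_abs, sq_abs]
    linarith
  · ext a
    constructor
    · intro ha
      have ha' : T a = a := ha
      have hNa : N a = a := by
        have h1 : N a = (2 : ℝ) • T a - a := by simp only [T]; module
        rw [h1, ha']
        module
      have hmono : Monotone fun k => ⟪x k, a⟫ := by
        refine monotone_nat_of_le_succ fun k => ?_
        have h1 := hN (x k) a
        rw [hNx, hNa] at h1
        have h2 : ‖u k - a‖ ^ 2 ≤ ‖x k - a‖ ^ 2 := by gcongr
        rw [norm_sub_sq_real (u k) a, norm_sub_sq_real (x k) a, hun] at h2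
        simp only [hu, inner_sub_left, inner_smul_left, RCLike.conj_to_real] at h2
        linarith
      have haP : a ∈ P := fun k => hmono.ge_of_tendsto (hweak a) k
      have := hNP a haP
      rw [hNa] at this
      exact this
    · intro ha
      have ha' : a = 0 := ha
      subst ha'
      have h0 : N 0 = 0 := hNP 0 (fun k => by simp)
      change T 0 = 0
      simp [T, h0]
  · intro w
    have h1 := (hweak w).cesaro
    refine h1.congr fun n => ?_
    rw [hsum, inner_smul_left, sum_inner, RCLike.conj_to_real, one_div]
  · simp only [hsum]
    apply le_antisymm
    · apply le_of_forall_pos_le_add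
      intro ε hε
      rw [zero_add]
      refine liminf_le_of_frequently_le ?_ hbdd'
      rw [frequently_atTop]
      intro N₀
      obtain ⟨K, hK0, hK⟩ := hmean (ε / 3) (by linarith)
      obtain ⟨n', n, h1, hlt, h2, hc, h3⟩ := hP2 (max (max (3 / ε) (3 * K / ε)) N₀)
      set C := max (max (3 / ε) (3 * K / ε)) (N₀ : ℝ)
      have hC1 : 3 / ε ≤ C := (le_max_left _ _).trans (le_max_left _ _)
      have hC2 : 3 * K / ε ≤ C := (le_max_right _ _).trans (le_max_left _ _)
      have hC3 : (N₀ : ℝ) ≤ C := le_max_right _ _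
      refine ⟨n, by exact_mod_cast hC3.trans h2, ?_⟩
      have hn0 : (0 : ℝ) < n := by exact_mod_cast (Nat.zero_le n').trans_lt hlt
      rw [norm_smul, Real.norm_eq_abs, abs_of_nonneg (by positivity), one_div, inv_mul_eq_div,
        div_le_iff₀ hn0]
      have hsplit : ∑ k ∈ Finset.range n, x k
          = ∑ k ∈ Finset.range (n' + 1), x k + ∑ k ∈ Finset.Ico n' (n - 1), x (k + 1) := by
        rw [Finset.sum_Ico_add' x n' (n - 1) 1, Nat.sub_add_cancel (by omega)]
        exact (Finset.sum_range_add_sum_Ico x (by omega)).symm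
      have hA : ‖∑ k ∈ Finset.range (n' + 1), x k‖ ≤ n' + 1 := by
        refine (norm_sum_le _ _).trans ?_
        have := Finset.sum_le_card_nsmul (Finset.range (n' + 1)) (fun k => ‖x k‖) 1
          fun k _ => hxle k
        simpa using this
      have hB := hK n' (n - 1) (δ n') (hpos _) (by omega) (fun k ha hb => hc k ha (by omega))
      have hn1 : ((n - 1 : ℕ) : ℝ) ≤ n := by exact_mod_cast Nat.sub_le _ _
      have hB2 : K / δ n' ≤ ε / 3 * n := by
        rw [div_le_iff₀ (hpos _)]
        have := hC2.trans h3
        rw [div_le_iff₀ hε] at this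
        linarith
      have hB3 : ε / 3 * ((n - 1 : ℕ) : ℝ) ≤ ε / 3 * n :=
        mul_le_mul_of_nonneg_left hn1 (by linarith)
      have hA2 : (n' : ℝ) + 1 ≤ ε / 3 * n := by
        have h4 : 3 / ε * ((n' : ℝ) + 1) ≤ n :=
          (mul_le_mul_of_nonneg_right hC1 (by positivity)).trans h1
        rw [div_mul_eq_mul_div, div_le_iff₀ hε] at h4
        linarith
      rw [hsplit]
      have := norm_add_le (∑ k ∈ Finset.range (n' + 1), x k)
        (∑ k ∈ Finset.Ico n' (n - 1), x (k + 1))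
      linarith
    · exact le_liminf_of_le hbdd.isCoboundedUnder_ge
        (Eventually.of_forall fun n => norm_nonneg _)
  · simp only [hsum]
    refine lt_of_lt_of_le (show (0 : ℝ) < 1 / 4 by norm_num) ?_
    refine le_limsup_of_frequently_le ?_ hbdd
    rw [frequently_atTop]
    intro N₀
    obtain ⟨n', n, hNn, hn'0, h16, hsm⟩ := hP1 N₀
    refine ⟨n, hNn, ?_⟩
    have hn0 : (0 : ℝ) < n := by
      have : 0 < n := by omega
      exact_mod_cast this
    have hstep : ∀ k, n' ≤ k → ‖x k - x n'‖ ≤ ((k : ℝ) - n') * δ n' := by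
      intro k hk
      induction k, hk using Nat.le_induction with
      | base => simp
      | succ k hk ih =>
        have h1 : ‖x (k + 1) - x k‖ ≤ δ n' := by
          rw [norm_sub_rev, ← hdz, norm_smul, Real.norm_eq_abs, abs_of_pos (hpos k)]
          calc δ k * ‖z k‖ ≤ δ n' * 1 :=
                mul_le_mul (hanti hk) (hz k) (norm_nonneg _) (hpos _).le
            _ = δ n' := mul_one _
        have h2 := norm_sub_le_norm_sub_add_norm_sub (x (k + 1)) (x k) (x n')
        push_cast
        linarith
    have hdiff : ‖∑ k ∈ Finset.range n, (x k - x n')‖ ≤ 2 * n' + 1 / 16 * n := by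
      rw [← Finset.sum_range_add_sum_Ico _ (show n' ≤ n by omega)]
      refine (norm_add_le _ _).trans (add_le_add ?_ ?_)
      · refine (norm_sum_le _ _).trans ?_
        have := Finset.sum_le_card_nsmul (Finset.range n') (fun k => ‖x k - x n'‖) 2 fun k _ => by
          have := norm_sub_le (x k) (x n')
          have := hxle k
          have := hxle n'
          linarith
        rw [Finset.card_range, nsmul_eq_mul] at this
        linarith
      · refine (norm_sum_le _ _).trans ?_
        have := Finset.sum_le_card_nsmul (Finset.Ico n' n) (fun k => ‖x k - x n'‖) (1 / 16)
          fun k hk => by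
            rw [Finset.mem_Ico] at hk
            refine (hstep k hk.1).trans (le_trans ?_ hsm)
            have h1 : (k : ℝ) ≤ n := by exact_mod_cast hk.2.le
            have h2 : (0 : ℝ) ≤ n' := by positivity
            exact mul_le_mul_of_nonneg_right (by linarith) (hpos _).le
        rw [Nat.card_Ico, nsmul_eq_mul] at this
        have h1 : ((n - n' : ℕ) : ℝ) ≤ n := by exact_mod_cast Nat.sub_le _ _
        linarith
    rw [Finset.sum_sub_distrib, Finset.sum_const, Finset.card_range] at hdiff
    have h1 : ‖n • x n'‖ = n * ‖x n'‖ := by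
      rw [← Nat.cast_smul_eq_nsmul ℝ, norm_smul, Real.norm_eq_abs, abs_of_pos hn0]
    have h2 : ‖n • x n'‖ - ‖∑ k ∈ Finset.range n, x k‖
        ≤ ‖∑ k ∈ Finset.range n, x k - n • x n'‖ := by
      rw [norm_sub_rev]
      exact norm_sub_norm_le _ _
    have h3 : (n : ℝ) * (1 / 2) ≤ n * ‖x n'‖ := mul_le_mul_of_nonneg_left (hxge n') hn0.le
    have h4 : (16 : ℝ) * n' ≤ n := by exact_mod_cast h16
    rw [norm_smul, Real.norm_eq_abs, abs_of_nonneg (by positivity), one_div (n : ℝ), inv_mul_eq_div,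
      le_div_iff₀ hn0]
    linarith
end
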